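/- arXiv:math/0007008 — 3 statements merged into one kernel-verified Lean document; each statement's English description precedes it below -/
import Mathlib

section
/- Let E = ⋃_m I_m, where I_m = [a_m, b_m] (a_m < b_m) are pairwise disjoint closed intervals in ℝ with dist(0, I_m) → ∞ as m → ∞, and suppose there are constants c > 0 and M < ∞ such that |I_m| = b_m − a_m ≥ c(1 + dist(0, I_m))^{-M} for every m. Let f be an entire function of the Krein class all of whose zeros lie in E. Then f is of bounded type in ℂ∖E: there exists a positive harmonic function h on ℂ∖E with log⁺|f(z)| ≤ h(z) for all z ∈ ℂ∖E. -/
open Complex Filter Set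

noncomputable def logPlus (t : ℝ) : ℝ := max (Real.log t) 0

/-- `h` is harmonic on `U`: real-valued, `C²` on `U`, with vanishing Laplacian. -/
def HarmonicOn (h : ℂ → ℝ) (U : Set ℂ) : Prop :=
  ContDiffOn ℝ 2 h U ∧ ∀ z ∈ U,
    iteratedFDerivWithin ℝ 2 h U z ![1, 1] +
      iteratedFDerivWithin ℝ 2 h U z ![Complex.I, Complex.I] = 0

/-- The subset of `ℂ` corresponding to a subset of `ℝ`. -/
def cplx (E : Set ℝ) : Set ℂ := (fun x : ℝ => (x : ℂ)) '' E

/-- `g` is of bounded type in `U`: `log⁺|g|` admits a positive harmonic majorant on `U`. -/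
def BoundedTypeOn (g : ℂ → ℂ) (U : Set ℂ) : Prop :=
  ∃ h : ℂ → ℝ, HarmonicOn h U ∧ (∀ z ∈ U, 0 < h z) ∧
    ∀ z ∈ U, logPlus ‖g z‖ ≤ h z

/-- `f` is an entire function of the Krein class, with (real, simple) zeros
enumerated by the sequence `lam`. -/
def KreinClass (f : ℂ → ℂ) (lam : ℕ → ℝ) : Prop :=
  Differentiable ℂ f ∧
  Function.Injective lam ∧
  (∀ z : ℂ, f z = 0 ↔ ∃ n, z = (lam n : ℂ)) ∧
  (∀ n, deriv f (lam n) ≠ 0) ∧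
  Summable (fun n => 1 / ‖deriv f (lam n)‖) ∧
  ∀ z : ℂ, f z ≠ 0 →
    Summable (fun n => ‖1 / (deriv f (lam n) * (z - (lam n : ℂ)))‖) ∧
    1 / f z = ∑' n, 1 / (deriv f (lam n) * (z - (lam n : ℂ)))

lemma harm_log (P : ℂ → ℂ) (U : Set ℂ) (hU : IsOpen U) (hP : DifferentiableOn ℂ P U)
    (h0 : ∀ z ∈ U, P z ≠ 0) : HarmonicOn (fun z => Real.log ‖P z‖) U := by
  have hh : ∀ z ∈ U, InnerProductSpace.HarmonicAt (fun z => Real.log ‖P z‖) z := fun z hz =>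
    AnalyticAt.harmonicAt_log_norm (hP.analyticAt (hU.mem_nhds hz)) (h0 z hz)
  refine ⟨fun z hz => (hh z hz).1.contDiffWithinAt, fun z hz => ?_⟩
  rw [iteratedFDerivWithin_of_isOpen 2 hU hz]
  have := (hh z hz).2.self_of_nhds
  rw [InnerProductSpace.laplacian_eq_iteratedFDeriv_complexPlane] at this
  simpa using this

noncomputable def qr (w : ℂ) : ℂ := exp (log w / 4)

lemma qr_pow {w : ℂ} (hw : w ≠ 0) : qr w ^ 4 = w := by
  unfold qr
  rw [← Complex.exp_nat_mul, show ((4 : ℕ) : ℂ) * (log w / 4) = log w by push_cast; ring,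
    Complex.exp_log hw]

lemma qr_re (w : ℂ) : 0 < (qr w).re ∧ ‖qr w‖ ^ 2 ≤ 2 * (qr w).re ^ 2 := by
  have him : (log w / 4).im = arg w / 4 := by
    rw [show (4 : ℂ) = ((4 : ℝ) : ℂ) by norm_num, Complex.div_ofReal_im, Complex.log_im]
  have h1 := Complex.neg_pi_lt_arg w
  have h2 := Complex.arg_le_pi w
  have hcos : Real.sqrt 2 / 2 ≤ Real.cos (arg w / 4) := by
    rw [← Real.cos_pi_div_four, ← Real.cos_abs (arg w / 4)]
    apply Real.cos_le_cos_of_nonneg_of_le_pi (abs_nonneg _)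
    · linarith [Real.pi_pos]
    · rw [abs_le]; constructor <;> linarith
  have hs : (0 : ℝ) < Real.sqrt 2 := by positivity
  have hs2 : Real.sqrt 2 ^ 2 = 2 := Real.sq_sqrt (by norm_num)
  have hre : (qr w).re = ‖qr w‖ * Real.cos (arg w / 4) := by
    unfold qr
    rw [Complex.exp_re, Complex.norm_exp, him]
  have hn : 0 < ‖qr w‖ := by unfold qr; rw [Complex.norm_exp]; positivity
  refine ⟨by rw [hre]; exact mul_pos hn (by linarith), ?_⟩
  rw [hre]
  have : 1 ≤ 2 * Real.cos (arg w / 4) ^ 2 := by nlinarith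
  nlinarith [sq_nonneg ‖qr w‖]

lemma qr_norm4 {w : ℂ} (hw : w ≠ 0) : ‖w‖ ≤ 4 * (qr w).re ^ 4 := by
  have h := qr_pow hw
  have : ‖w‖ = ‖qr w‖ ^ 4 := by rw [← norm_pow, h]
  rw [this]
  have h2 := (qr_re w).2
  nlinarith [sq_nonneg ‖qr w‖]

lemma qr_norm_le {w : ℂ} (hw : w ≠ 0) : ‖qr w‖ ≤ 1 + ‖w‖ := by
  have h := qr_pow hw
  have : ‖w‖ = ‖qr w‖ ^ 4 := by rw [← norm_pow, h]
  rw [this]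
  nlinarith [sq_nonneg (‖qr w‖ ^ 2 - 1/2), sq_nonneg (‖qr w‖ - 1/2)]

lemma qr_diff {U : Set ℂ} {F : ℂ → ℂ} (hF : DifferentiableOn ℂ F U)
    (hs : ∀ z ∈ U, F z ∈ slitPlane) : DifferentiableOn ℂ (fun z => qr (F z)) U := by
  unfold qr
  exact ((hF.clog hs).div_const 4).cexp

noncomputable def cau {ι : Type*} (c l : ι → ℝ) (z : ℂ) : ℂ := ∑' i, (c i : ℂ) / (z - (l i : ℂ))

section
variable {ι : Type*} (c l : ι → ℝ)

lemma cau_term (hc : ∀ i, 0 ≤ c i) {z : ℂ} {r : ℝ} (hr : 0 < r)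
    (h : ∀ i, r ≤ ‖z - (l i : ℂ)‖) (i : ι) :
    ‖(c i : ℂ) / (z - (l i : ℂ))‖ ≤ c i * (1 / r) := by
  rw [norm_div, Complex.norm_real, Real.norm_of_nonneg (hc i), div_eq_mul_one_div]
  exact mul_le_mul_of_nonneg_left (one_div_le_one_div_of_le hr (h i)) (hc i)

lemma cau_summable (hc : ∀ i, 0 ≤ c i) (hs : Summable c) {z : ℂ} {r : ℝ} (hr : 0 < r)
    (h : ∀ i, r ≤ ‖z - (l i : ℂ)‖) : Summable (fun i => ‖(c i : ℂ) / (z - (l i : ℂ))‖) :=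
  Summable.of_nonneg_of_le (fun _ => norm_nonneg _) (cau_term c l hc hr h) (hs.mul_right _)

lemma cau_norm_le (hc : ∀ i, 0 ≤ c i) (hs : Summable c) {z : ℂ} {r : ℝ} (hr : 0 < r)
    (h : ∀ i, r ≤ ‖z - (l i : ℂ)‖) : ‖cau c l z‖ ≤ (∑' i, c i) * (1 / r) :=
  tsum_of_norm_bounded (hs.hasSum.mul_right _) (cau_term c l hc hr h)

lemma cau_diff (hc : ∀ i, 0 ≤ c i) (hs : Summable c) {U : Set ℂ} (hU : IsOpen U) {r : ℝ}
    (hr : 0 < r) (h : ∀ z ∈ U, ∀ i, r ≤ ‖z - (l i : ℂ)‖) : DifferentiableOn ℂ (cau c l) U := by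
  unfold cau
  refine differentiableOn_tsum_of_summable_norm (u := fun i => c i * (1 / r)) (hs.mul_right _)
    (fun i => ?_) hU (fun i w hw => cau_term c l hc hr (h w hw) i)
  refine DifferentiableOn.div (by fun_prop) (by fun_prop) (fun z hz h0 => ?_)
  have := h z hz i
  rw [h0, norm_zero] at this
  linarith

lemma cau_bd (hc : ∀ i, 0 ≤ c i) (hs : Summable c) {z : ℂ} {r a b e k : ℝ} (hr : 0 < r)
    (hab : a < b) (hk : k = 1 / (b - a))
    (hl : ∀ i, l i ∈ Icc a b) (he : e ∈ Icc a b)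
    (h : ∀ i, r ≤ ‖z - (l i : ℂ)‖) :
    ‖(z - e) * k * cau c l z‖ ≤ (∑' i, c i) * (k + 1 / r) := by
  have hk0 : 0 < k := by rw [hk]; exact one_div_pos.2 (by linarith)
  unfold cau
  rw [← tsum_mul_left]
  refine tsum_of_norm_bounded (hs.hasSum.mul_right _) (fun i => ?_)
  have hn : 0 < ‖z - (l i : ℂ)‖ := lt_of_lt_of_le hr (h i)
  rw [norm_mul, norm_mul, norm_div, Complex.norm_real, Complex.norm_real,
    Real.norm_of_nonneg (hc i), Real.norm_of_nonneg hk0.le]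
  have h1 : ‖z - (e : ℂ)‖ ≤ ‖z - (l i : ℂ)‖ + (b - a) := by
    have : z - (e : ℂ) = (z - (l i : ℂ)) + ((l i - e : ℝ) : ℂ) := by push_cast; ring
    rw [this]
    refine (norm_add_le _ _).trans ?_
    rw [Complex.norm_real, Real.norm_eq_abs]
    have : |l i - e| ≤ b - a := by
      rw [abs_le]; constructor <;> linarith [(hl i).1, (hl i).2, he.1, he.2]
    linarith
  have h2 : ‖z - (e : ℂ)‖ * k / ‖z - (l i : ℂ)‖ ≤ k + 1 / r := by
    have h3 : (b - a) * k = 1 := by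
      rw [hk]; field_simp [sub_ne_zero.2 hab.ne']
    have h4 : 1 / ‖z - (l i : ℂ)‖ ≤ 1 / r := one_div_le_one_div_of_le hr (h i)
    have : ‖z - (e : ℂ)‖ * k / ‖z - (l i : ℂ)‖ ≤ k + 1 / ‖z - (l i : ℂ)‖ := by
      rw [div_le_iff₀ hn, add_mul, one_div_mul_cancel hn.ne']
      nlinarith
    linarith
  calc ‖z - (e : ℂ)‖ * k * (c i / ‖z - (l i : ℂ)‖)
      = c i * (‖z - (e : ℂ)‖ * k / ‖z - (l i : ℂ)‖) := by ring
    _ ≤ _ := mul_le_mul_of_nonneg_left h2 (hc i)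

lemma cau_slit (hc : ∀ i, 0 ≤ c i) (hs : Summable c) {z : ℂ} {r a b e k : ℝ} (hr : 0 < r)
    (hk : 0 < k) (hl : ∀ i, l i ∈ Icc a b) (he : e ∈ Icc a b) (hz : z ∉ cplx (Icc a b))
    (h : ∀ i, r ≤ ‖z - (l i : ℂ)‖) :
    1 + (z - e) * k * cau c l z ∈ slitPlane := by
  have hsum := (cau_summable c l hc hs hr h).of_norm
  by_contra hcon
  rw [Complex.mem_slitPlane_iff] at hcon
  push Not at hcon
  obtain ⟨hre, him⟩ := hcon
  have hcre : (cau c l z).re = ∑' i, ((c i : ℂ) / (z - (l i : ℂ))).re := Complex.re_tsum hsum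
  have hcim : (cau c l z).im = ∑' i, ((c i : ℂ) / (z - (l i : ℂ))).im := Complex.im_tsum hsum
  by_cases hy : z.im = 0
  · -- real point
    obtain ⟨x, rfl⟩ : ∃ x : ℝ, z = x := ⟨z.re, by apply Complex.ext <;> simp [hy]⟩
    have hterm : ∀ i, ((c i : ℂ) / ((x : ℂ) - (l i : ℂ))) = ((c i / (x - l i) : ℝ) : ℂ) := by
      intro i; push_cast; rfl
    have hca : cau c l x = ((∑' i, c i / (x - l i) : ℝ) : ℂ) := by
      unfold cau
      simp_rw [hterm]
      rw [Complex.ofReal_tsum]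
    rw [hca] at hre
    have : (1 + ((x : ℂ) - e) * k * ((∑' i, c i / (x - l i) : ℝ) : ℂ)) =
        ((1 + (x - e) * k * (∑' i, c i / (x - l i)) : ℝ) : ℂ) := by push_cast; ring
    rw [this, Complex.ofReal_re] at hre
    have hx : x < a ∨ b < x := by
      by_contra hcon
      push Not at hcon
      exact hz ⟨x, hcon, rfl⟩
    have : 0 ≤ (x - e) * (∑' i, c i / (x - l i)) := by
      rw [← tsum_mul_left]
      refine tsum_nonneg (fun i => ?_)
      have := hl i
      rcases hx with hx | hx
      · have h1 : x - e ≤ 0 := by linarith [he.1]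
        have h2 : x - l i ≤ 0 := by linarith [this.1]
        exact mul_nonneg_of_nonpos_of_nonpos h1 (div_nonpos_of_nonneg_of_nonpos (hc i) h2)
      · have h1 : 0 ≤ x - e := by linarith [he.2]
        have h2 : 0 ≤ x - l i := by linarith [this.2]
        exact mul_nonneg h1 (div_nonneg (hc i) h2)
    nlinarith
  · -- non-real point
    have hze : z - e ≠ 0 := by
      intro h0
      apply hy
      have := congrArg Complex.im h0
      simpa using this
    obtain ⟨t, ht⟩ : ∃ t : ℝ, t = (1 + (z - e) * k * cau c l z).re := ⟨_, rfl⟩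
    have hF : 1 + (z - e) * k * cau c l z = t := by
      apply Complex.ext
      · simp [ht]
      · simpa using him
    have ht0 : t ≤ 0 := by rw [ht]; exact hre
    have hk' : (k : ℂ) ≠ 0 := by exact_mod_cast hk.ne'
    have hg : cau c l z = (((t - 1) / k : ℝ) : ℂ) / (z - e) := by
      rw [eq_div_iff hze]
      push_cast
      rw [eq_div_iff hk']
      linear_combination hF
    have key : ∀ (s e : ℝ), ((s : ℂ) / (z - (e : ℂ))).im = -z.im * (s / Complex.normSq (z - e)) := by
      intro s e
      rw [Complex.div_im]
      simp
      ring
    have h1 : (cau c l z).im = -z.im * ∑' i, c i / Complex.normSq (z - l i) := by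
      rw [hcim, ← tsum_mul_left]
      exact tsum_congr (fun i => key _ _)
    have h2 : (cau c l z).im = -z.im * (((t - 1) / k) / Complex.normSq (z - e)) := by
      rw [hg, key]
    have h3 := mul_left_cancel₀ (neg_ne_zero.2 hy) (h1.symm.trans h2)
    have h4 : 0 ≤ ∑' i, c i / Complex.normSq (z - l i) :=
      tsum_nonneg (fun i => div_nonneg (hc i) (Complex.normSq_nonneg _))
    have h5 : ((t - 1) / k) / Complex.normSq (z - e) < 0 :=
      div_neg_of_neg_of_pos (div_neg_of_neg_of_pos (by linarith) hk) (Complex.normSq_pos.2 hze)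
    linarith
end

lemma core (a b : ℕ → ℝ) (hab : ∀ m, a m < b m) (E : Set ℝ) (hE : E = ⋃ m, Icc (a m) (b m))
    (hO : IsOpen (cplx E)ᶜ) (D w : ℕ → ℝ) (hD1 : ∀ m, 1 ≤ D m)
    (hD : ∀ m, ∀ x ∈ Icc (a m) (b m), D m ≤ 1 + |x|)
    (hw : ∀ m, 0 < w m) (hws : Summable w) (hws' : Summable (fun m => w m * (1 / (b m - a m))))
    (K : ℕ) (hK : ∀ m, 1 / w m ≤ D m ^ K)
    (Ψ : ℂ → ℂ) (hΨ : DifferentiableOn ℂ Ψ (cplx E)ᶜ)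
    (hΨ' : ∀ z ∈ (cplx E)ᶜ, 2 * ‖z‖ + 2 ≤ ‖Ψ z‖)
    (lam : ℕ → ℝ) (hlam : ∀ n, lam n ∈ E)
    (c : ℕ → ℝ) (hc : ∀ i, 0 ≤ c i) (hs : Summable c) :
    ∃ Q : ℂ → ℂ, DifferentiableOn ℂ Q (cplx E)ᶜ ∧
      ∀ z ∈ (cplx E)ᶜ, 1 ≤ ‖Q z‖ ∧ ‖cau c lam z‖ ≤ ‖Q z‖ := by
  have hmm : ∀ n, ∃ m, lam n ∈ Icc (a m) (b m) := by
    intro n; have := hlam n; rw [hE] at this; simpa only [mem_iUnion] using this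
  choose mm hmm using hmm
  set U := (cplx E)ᶜ with hU
  -- fibre data
  let cf : (m : ℕ) → (mm ⁻¹' {m}) → ℝ := fun m n => c n
  let lf : (m : ℕ) → (mm ⁻¹' {m}) → ℝ := fun m n => lam n
  let k : ℕ → ℝ := fun m => 1 / (b m - a m)
  have hk0 : ∀ m, 0 < k m := fun m => one_div_pos.2 (by linarith [hab m])
  let g : ℕ → ℂ → ℂ := fun m => cau (cf m) (lf m)
  have hcf : ∀ m i, 0 ≤ cf m i := fun m i => hc i
  have hsf : ∀ m, Summable (cf m) := fun m => hs.subtype _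
  have hlf : ∀ m i, lf m i ∈ Icc (a m) (b m) := by
    rintro m ⟨n, hn⟩
    have : mm n = m := hn
    subst this
    exact hmm n
  let μ : ℝ := ∑' n, c n
  let μf : ℕ → ℝ := fun m => ∑' i, cf m i
  have hμf : HasSum μf μ := hs.hasSum.tsum_fiberwise mm
  have hμf0 : ∀ m, 0 ≤ μf m := fun m => tsum_nonneg (hcf m)
  have hμ0 : 0 ≤ μ := tsum_nonneg hc
  have hμle : ∀ m, μf m ≤ μ := fun m => le_hasSum hμf m (fun j _ => hμf0 j)
  have hsubE : ∀ m, Icc (a m) (b m) ⊆ E := by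
    intro m; rw [hE]; exact subset_iUnion (fun m => Icc (a m) (b m)) m
  have hzI : ∀ z ∈ U, ∀ m, z ∉ cplx (Icc (a m) (b m)) := fun z hz m h =>
    hz (image_mono (hsubE m) h)
  -- local distances
  have hloc : ∀ z ∈ U, ∃ r > 0, Metric.ball z r ⊆ U ∧
      ∀ y ∈ Metric.ball z r, ∀ x ∈ E, r ≤ ‖y - (x : ℂ)‖ := by
    intro z hz
    obtain ⟨r, hr, hb⟩ := Metric.isOpen_iff.1 hO z hz
    refine ⟨r / 2, by positivity, (Metric.ball_subset_ball (by linarith)).trans hb, ?_⟩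
    intro y hy x hx
    by_contra hcon
    push Not at hcon
    have : (x : ℂ) ∈ Metric.ball z r := by
      rw [Metric.mem_ball] at hy ⊢
      have h1 := dist_triangle (x : ℂ) y z
      rw [dist_comm (x : ℂ) y, dist_eq_norm y] at h1
      linarith
    exact hb this ⟨x, hx, rfl⟩
  have hlfE : ∀ m i, lf m i ∈ E := fun m i => hsubE m (hlf m i)
  let F : ℕ → ℝ → ℂ → ℂ := fun m e z => 1 + (z - e) * k m * g m z
  have hslit : ∀ z ∈ U, ∀ m, ∀ e ∈ Icc (a m) (b m), F m e z ∈ slitPlane := by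
    intro z hz m e he
    obtain ⟨r, hr, -, h2⟩ := hloc z hz
    exact cau_slit (cf m) (lf m) (hcf m) (hsf m) hr (hk0 m) (hlf m) he (hzI z hz m)
      (fun i => h2 z (Metric.mem_ball_self hr) _ (hlfE m i))
  have hA : ∀ m, a m ∈ Icc (a m) (b m) := fun m => ⟨le_rfl, (hab m).le⟩
  have hB : ∀ m, b m ∈ Icc (a m) (b m) := fun m => ⟨(hab m).le, le_rfl⟩
  let T : ℕ → ℂ → ℂ := fun m z => (w m : ℂ) * (qr (F m (a m) z) + qr (F m (b m) z))
  let u : ℝ → ℕ → ℝ := fun r m => w m * (4 + 2 * (μ * (1 / r))) + 2 * μ * (w m * (1 / (b m - a m)))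
  have hu : ∀ r, Summable (u r) := fun r => (hws.mul_right _).add (hws'.mul_left _)
  have hTb : ∀ z ∈ U, ∀ r > 0, (∀ x ∈ E, r ≤ ‖z - (x : ℂ)‖) → ∀ m, ‖T m z‖ ≤ u r m := by
    intro z hz r hr h m
    have key : ∀ e ∈ Icc (a m) (b m), ‖qr (F m e z)‖ ≤ 2 + μ * (k m + 1 / r) := by
      intro e he
      have h1 := qr_norm_le (slitPlane_ne_zero (hslit z hz m e he))
      have h2 := cau_bd (cf m) (lf m) (hcf m) (hsf m) hr (hab m) rfl (hlf m) he
        (fun i => h _ (hlfE m i)) (z := z)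
      have h3 : ‖F m e z‖ ≤ 1 + ‖(z - e) * k m * g m z‖ := by
        refine (norm_add_le _ _).trans ?_
        simp
      have h4 : μf m * (k m + 1 / r) ≤ μ * (k m + 1 / r) :=
        mul_le_mul_of_nonneg_right (hμle m) (by have := hk0 m; positivity)
      have h2' : ‖(z - e) * k m * g m z‖ ≤ μf m * (k m + 1 / r) := h2
      linarith
    have h1 := key _ (hA m)
    have h2 := key _ (hB m)
    have h3 := norm_add_le (qr (F m (a m) z)) (qr (F m (b m) z))
    calc ‖T m z‖ = w m * ‖qr (F m (a m) z) + qr (F m (b m) z)‖ := by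
          simp only [T]
          rw [norm_mul, Complex.norm_real, Real.norm_of_nonneg (hw m).le]
      _ ≤ w m * (2 * (2 + μ * (k m + 1 / r))) :=
          mul_le_mul_of_nonneg_left (by linarith) (hw m).le
      _ = u r m := by simp only [u, k]; ring
  have hTd : ∀ z ∈ U, ∃ r > 0, Metric.ball z r ⊆ U ∧
      DifferentiableOn ℂ (fun y => ∑' m, T m y) (Metric.ball z r) := by
    intro z hz
    obtain ⟨r, hr, hb, h2⟩ := hloc z hz
    refine ⟨r, hr, hb, differentiableOn_tsum_of_summable_norm (hu r) (fun m => ?_)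
      Metric.isOpen_ball (fun m y hy => hTb y (hb hy) r hr (h2 y hy) m)⟩
    have hg : DifferentiableOn ℂ (g m) (Metric.ball z r) :=
      cau_diff (cf m) (lf m) (hcf m) (hsf m) Metric.isOpen_ball hr
        (fun y hy i => h2 y hy _ (hlfE m i))
    have hFd : ∀ e, DifferentiableOn ℂ (F m e) (Metric.ball z r) := fun e => by
      simp only [F]; fun_prop
    exact ((qr_diff (hFd _) (fun y hy => hslit y (hb hy) m _ (hA m))).add
      (qr_diff (hFd _) (fun y hy => hslit y (hb hy) m _ (hB m)))).const_mul _
  let Φ : ℂ → ℂ := fun z => 1 + ∑' m, T m z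
  have hΦd : DifferentiableOn ℂ Φ U := by
    intro z hz
    obtain ⟨r, hr, -, h⟩ := hTd z hz
    exact (((h.differentiableAt (Metric.ball_mem_nhds z hr))).const_add 1).differentiableWithinAt
  refine ⟨fun z => ((5 + μ : ℝ) : ℂ) * Ψ z ^ (4 * K) * Φ z ^ 4,
    ((hΨ.pow _).const_mul _).mul (hΦd.pow _), ?_⟩
  intro z hz
  obtain ⟨r, hr, -, h2⟩ := hloc z hz
  have h2 := h2 z (Metric.mem_ball_self hr)
  have hTs : Summable (fun m => T m z) :=
    Summable.of_norm_bounded (hu r) (hTb z hz r hr h2)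
  let ρ : ℕ → ℝ := fun m => (qr (F m (a m) z)).re + (qr (F m (b m) z)).re
  have hρ0 : ∀ m, 0 < ρ m := fun m => add_pos (qr_re _).1 (qr_re _).1
  have hTre : ∀ m, (T m z).re = w m * ρ m := by
    intro m; simp [T, ρ]
  have hρs : HasSum (fun m => w m * ρ m) (∑' m, T m z).re := by
    have := Complex.hasSum_re hTs.hasSum
    simpa only [hTre] using this
  let R : ℝ := (Φ z).re
  have hR : R = 1 + (∑' m, T m z).re := by simp [R, Φ]
  have hwρ : ∀ m, w m * ρ m ≤ R := by
    intro m
    have := le_hasSum hρs m (fun j _ => (mul_pos (hw j) (hρ0 j)).le)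
    linarith
  have hR1 : 1 ≤ R := by
    have := hρs.nonneg (fun j => (mul_pos (hw j) (hρ0 j)).le)
    linarith
  have hRΦ : R ≤ ‖Φ z‖ := Complex.re_le_norm _
  let V : ℝ := 2 * ‖z‖ + 2
  have hV1 : 1 ≤ V := by have := norm_nonneg z; simp only [V]; linarith
  have hgm : ∀ m, ‖g m z‖ ≤ μf m + 4 * V ^ (4 * K) * R ^ 3 * (w m * ρ m) := by
    intro m
    have hwp := mul_pos (hw m) (hρ0 m)
    by_cases hnear : D m ≤ V
    · have h3 : g m z = F m (a m) z - F m (b m) z := by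
        have h4 : ((b m : ℂ) - a m) * k m = 1 := by
          have : (b m - a m) * k m = 1 := mul_one_div_cancel (by linarith [hab m])
          exact_mod_cast this
        simp only [F]
        linear_combination (-(g m z)) * h4
      have h4 := qr_norm4 (slitPlane_ne_zero (hslit z hz m _ (hA m)))
      have h5 := qr_norm4 (slitPlane_ne_zero (hslit z hz m _ (hB m)))
      have h6 : ‖g m z‖ ≤ 4 * ρ m ^ 4 := by
        rw [h3]
        refine (norm_sub_le _ _).trans ?_
        have p1 := (qr_re (F m (a m) z)).1
        have p2 := (qr_re (F m (b m) z)).1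
        have : (qr (F m (a m) z)).re ^ 4 + (qr (F m (b m) z)).re ^ 4 ≤ ρ m ^ 4 :=
          pow_add_pow_le p1.le p2.le (by norm_num)
        linarith
      have h7 : 1 ≤ w m * V ^ K := by
        have h8 : 1 / w m ≤ V ^ K := (hK m).trans
          (pow_le_pow_left₀ (by linarith [hD1 m]) hnear K)
        rw [div_le_iff₀ (hw m)] at h8
        linarith
      have h8 : 1 ≤ w m ^ 4 * V ^ (4 * K) := by
        have : w m ^ 4 * V ^ (4 * K) = (w m * V ^ K) ^ 4 := by rw [mul_pow, ← pow_mul, mul_comm K]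
        rw [this]
        exact one_le_pow₀ h7
      have h9 : (w m * ρ m) ^ 3 ≤ R ^ 3 := pow_le_pow_left₀ hwp.le (hwρ m) 3
      calc ‖g m z‖ ≤ 4 * ρ m ^ 4 := h6
        _ ≤ (4 * ρ m ^ 4) * (w m ^ 4 * V ^ (4 * K)) :=
            le_mul_of_one_le_right (by have := hρ0 m; positivity) h8
        _ = 4 * V ^ (4 * K) * (w m * ρ m) * (w m * ρ m) ^ 3 := by ring
        _ ≤ 4 * V ^ (4 * K) * (w m * ρ m) * R ^ 3 :=
            mul_le_mul_of_nonneg_left h9 (by positivity)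
        _ = 4 * V ^ (4 * K) * R ^ 3 * (w m * ρ m) := by ring
        _ ≤ _ := by linarith [hμf0 m]
    · push Not at hnear
      have h3 : ∀ i, 1 ≤ ‖z - (lf m i : ℂ)‖ := by
        intro i
        have h4 := hD m _ (hlf m i)
        have h5 : |lf m i| ≤ ‖z - (lf m i : ℂ)‖ + ‖z‖ := by
          have := norm_sub_norm_le (lf m i : ℂ) z
          rw [norm_sub_rev, Complex.norm_real, Real.norm_eq_abs] at this
          linarith
        have := norm_nonneg z
        simp only [V] at hnear
        linarith
      have h4 := cau_norm_le (cf m) (lf m) (hcf m) (hsf m) one_pos h3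
      have h5 : ‖g m z‖ ≤ μf m * (1 / 1) := h4
      have : 0 ≤ 4 * V ^ (4 * K) * R ^ 3 * (w m * ρ m) := by positivity
      linarith
  have hgs : HasSum (fun m => g m z) (cau c lam z) :=
    (cau_summable c lam hc hs hr (fun i => h2 _ (hlam i))).of_norm.hasSum.tsum_fiberwise mm
  have hfin : ‖cau c lam z‖ ≤ μ + 4 * V ^ (4 * K) * R ^ 3 * (∑' m, T m z).re := by
    rw [← hgs.tsum_eq]
    exact tsum_of_norm_bounded (hμf.add (hρs.mul_left _)) hgm
  have hVK : 1 ≤ V ^ (4 * K) := one_le_pow₀ hV1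
  have hR4 : 1 ≤ R ^ 4 := one_le_pow₀ hR1
  have hQ : (5 + μ) * V ^ (4 * K) * R ^ 4 ≤ ‖((5 + μ : ℝ) : ℂ) * Ψ z ^ (4 * K) * Φ z ^ 4‖ := by
    rw [norm_mul, norm_mul, norm_pow, norm_pow, Complex.norm_real,
      Real.norm_of_nonneg (by linarith)]
    have := hΨ' z hz
    gcongr
  have hVR : 1 ≤ V ^ (4 * K) * R ^ 4 := one_le_mul_of_one_le_of_one_le hVK hR4
  constructor
  · refine le_trans ?_ hQ
    rw [mul_assoc]; nlinarith
  · refine le_trans (hfin.trans ?_) hQ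
    have h3 : V ^ (4 * K) * R ^ 3 * (∑' m, T m z).re ≤ V ^ (4 * K) * R ^ 3 * R :=
      mul_le_mul_of_nonneg_left (by linarith) (by positivity)
    have h4 : V ^ (4 * K) * R ^ 3 * R = V ^ (4 * K) * R ^ 4 := by ring
    rw [h4] at h3
    nlinarith

lemma psi (a b : ℝ) (hab : a < b) : ∃ Ψ : ℂ → ℂ, DifferentiableOn ℂ Ψ (cplx (Icc a b))ᶜ ∧
    ∀ z ∈ (cplx (Icc a b))ᶜ, 2 * ‖z‖ + 2 ≤ ‖Ψ z‖ := by
  have hza : ∀ z ∈ (cplx (Icc a b))ᶜ, z - (a : ℂ) ≠ 0 := by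
    intro z hz h
    exact hz ⟨a, ⟨le_rfl, hab.le⟩, (sub_eq_zero.1 h).symm⟩
  have hsl : ∀ z ∈ (cplx (Icc a b))ᶜ, (z - (b : ℂ)) / (z - (a : ℂ)) ∈ slitPlane := by
    intro z hz
    by_contra hcon
    rw [Complex.mem_slitPlane_iff] at hcon
    push Not at hcon
    obtain ⟨hre, him⟩ := hcon
    obtain ⟨t, ht⟩ : ∃ t : ℝ, t = ((z - (b : ℂ)) / (z - (a : ℂ))).re := ⟨_, rfl⟩
    have hF : (z - (b : ℂ)) / (z - (a : ℂ)) = t := by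
      apply Complex.ext
      · simp [ht]
      · simpa using him
    have ht0 : t ≤ 0 := ht ▸ hre
    rw [div_eq_iff (hza z hz)] at hF
    have h1 := congrArg Complex.re hF
    have h2 := congrArg Complex.im hF
    simp at h1 h2
    have h3 : z.im = 0 := by
      have : (1 - t) * z.im = 0 := by linarith
      rcases mul_eq_zero.1 this with h | h
      · linarith
      · exact h
    apply hz
    refine ⟨z.re, ⟨?_, ?_⟩, by apply Complex.ext <;> simp [h3]⟩
    · by_contra hlt; push Not at hlt; nlinarith
    · by_contra hlt; push Not at hlt; nlinarith
  let C : ℝ := 2 * (2 + 2 * ((2 + |a| + |b|) / (b - a)))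
  refine ⟨fun z => (C : ℂ) * ((z - a) * (1 + qr ((z - (b : ℂ)) / (z - (a : ℂ)))) ^ 4), ?_, ?_⟩
  · have : DifferentiableOn ℂ (fun z : ℂ => (z - (b : ℂ)) / (z - (a : ℂ))) (cplx (Icc a b))ᶜ :=
      DifferentiableOn.div (by fun_prop) (by fun_prop) hza
    have h2 := qr_diff this hsl
    fun_prop
  · intro z hz
    have hba : 0 < b - a := by linarith
    set H := (z - (b : ℂ)) / (z - (a : ℂ)) with hH
    have hq := qr_re H
    have h1 : 1 ≤ ‖1 + qr H‖ := by
      have := Complex.re_le_norm (1 + qr H)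
      simp at this
      linarith [hq.1]
    have h2 : ‖qr H‖ ≤ ‖1 + qr H‖ := by
      rw [← sq_le_sq₀ (norm_nonneg _) (norm_nonneg _), ← Complex.normSq_eq_norm_sq,
        ← Complex.normSq_eq_norm_sq, Complex.normSq_apply, Complex.normSq_apply]
      simp
      nlinarith [hq.1]
    have h3 : ‖H‖ = ‖qr H‖ ^ 4 := by rw [← norm_pow, qr_pow (slitPlane_ne_zero (hsl z hz))]
    have h4 : ‖z - b‖ = ‖z - a‖ * ‖H‖ := by
      rw [hH, norm_div, mul_div_cancel₀ _ (norm_ne_zero_iff.2 (hza z hz))]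
    have h5 : ‖z - b‖ ≤ ‖z - a‖ * ‖1 + qr H‖ ^ 4 := by
      rw [h4, h3]; gcongr
    have h6 : ‖z - a‖ ≤ ‖z - a‖ * ‖1 + qr H‖ ^ 4 :=
      le_mul_of_one_le_right (norm_nonneg _) (one_le_pow₀ h1)
    set X := ‖z - a‖ * ‖1 + qr H‖ ^ 4 with hX
    have hC : 0 ≤ C := by simp only [C]; positivity
    rw [norm_mul, norm_mul, norm_pow, Complex.norm_real, Real.norm_of_nonneg hC, ← hX]
    have h7 : b - a ≤ 2 * X := by
      have : ‖((b - a : ℝ) : ℂ)‖ ≤ ‖z - a‖ + ‖z - b‖ := by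
        rw [show ((b - a : ℝ) : ℂ) = (z - a) - (z - b) by push_cast; ring]
        exact norm_sub_le _ _
      rw [Complex.norm_real, Real.norm_of_nonneg hba.le] at this
      linarith
    have h8 : ‖z‖ ≤ X + |a| := by
      have := norm_sub_norm_le z (a : ℂ)
      rw [Complex.norm_real, Real.norm_eq_abs] at this
      linarith
    have h9 : (2 + |a| + |b|) ≤ (2 + |a| + |b|) / (b - a) * (2 * X) := by
      rw [div_mul_eq_mul_div, le_div_iff₀ hba]
      exact mul_le_mul_of_nonneg_left h7 (by positivity)
    have hX0 : 0 ≤ X := by positivity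
    have hCX : C * X = 4 * X + 2 * ((2 + |a| + |b|) / (b - a) * (2 * X)) := by simp only [C]; ring
    have : 0 ≤ (2 + |a| + |b|) / (b - a) * (2 * X) := by positivity
    rw [hCX]
    have := abs_nonneg b
    linarith

lemma count_int (a b d l : ℝ) (hd0 : 0 ≤ d) (hl0 : 0 ≤ l) (hl1 : l ≤ 1) (hl : 2 * l ≤ b - a)
    (x0 : ℝ) (hx0 : x0 ∈ Icc a b) (hxd : |x0| ≤ d) :
    l * (2 * (1 + d) ^ 2)⁻¹ ≤ ∫ x in Icc a b, (1 + x ^ 2)⁻¹ := by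
  obtain ⟨p, hp1, hp2, hp3⟩ : ∃ p, a ≤ p ∧ p + l ≤ b ∧ ∀ x ∈ Icc p (p + l), |x| ≤ 1 + d := by
    rw [abs_le] at hxd
    by_cases h : x0 + l ≤ b
    · refine ⟨x0, hx0.1, h, fun x hx => ?_⟩
      rw [abs_le]; constructor <;> linarith [hx.1, hx.2]
    · push Not at h
      refine ⟨x0 - l, by linarith, by linarith [hx0.2], fun x hx => ?_⟩
      rw [abs_le]; constructor <;> linarith [hx.1, hx.2]
  have hint : MeasureTheory.Integrable (fun x : ℝ => (1 + x ^ 2)⁻¹) := integrable_inv_one_add_sq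
  calc l * (2 * (1 + d) ^ 2)⁻¹ = ∫ x in Icc p (p + l), (2 * (1 + d) ^ 2)⁻¹ := by
        rw [MeasureTheory.setIntegral_const]
        simp [MeasureTheory.measureReal_def, hl0]
    _ ≤ ∫ x in Icc p (p + l), (1 + x ^ 2)⁻¹ := by
        refine MeasureTheory.setIntegral_mono_on
          (MeasureTheory.integrableOn_const (by simp)) hint.integrableOn measurableSet_Icc
          (fun x hx => ?_)
        have := hp3 x hx
        apply inv_anti₀ (by positivity)
        have h2 : x ^ 2 ≤ (1 + d) ^ 2 := by
          rw [← sq_abs x]; exact pow_le_pow_left₀ (abs_nonneg _) this 2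
        nlinarith
    _ ≤ ∫ x in Icc a b, (1 + x ^ 2)⁻¹ := by
        refine MeasureTheory.setIntegral_mono_set hint.integrableOn
          (Eventually.of_forall fun x => by positivity) ?_
        exact (Icc_subset_Icc hp1 hp2).eventuallyLE

lemma counting (a b : ℕ → ℝ)
    (hdisj : ∀ m n, m ≠ n → Disjoint (Icc (a m) (b m)) (Icc (a n) (b n)))
    (d : ℕ → ℝ) (hd0 : ∀ m, 0 ≤ d m) (c : ℝ) (N : ℕ) (hc : 0 < c)
    (hx : ∀ m, ∃ x ∈ Icc (a m) (b m), |x| ≤ d m)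
    (hlen : ∀ m, c * (1 / (1 + d m)) ^ N ≤ b m - a m) :
    Summable (fun m => (1 / (1 + d m)) ^ (N + 2)) := by
  have hint : MeasureTheory.Integrable (fun x : ℝ => (1 + x ^ 2)⁻¹) := integrable_inv_one_add_sq
  have hsum := (MeasureTheory.hasSum_integral_iUnion (f := fun x : ℝ => (1 + x ^ 2)⁻¹)
    (μ := MeasureTheory.volume) (s := fun m => Icc (a m) (b m))
    (fun m => measurableSet_Icc) (fun m n h => hdisj m n h) hint.integrableOn).summable
  let c' : ℝ := min (c / 2) 1
  have hc' : 0 < c' := by simp only [c']; positivity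
  refine Summable.of_nonneg_of_le (fun m => ?_) (fun m => ?_) (hsum.mul_left (2 / c'))
  · have := hd0 m; positivity
  · have hd := hd0 m
    obtain ⟨x, hx1, hx2⟩ := hx m
    have hq0 : 0 ≤ (1 / (1 + d m)) ^ N := by positivity
    have hq1 : (1 / (1 + d m)) ^ N ≤ 1 :=
      pow_le_one₀ (by positivity) (by rw [div_le_one (by linarith)]; linarith)
    have hc1 : c' ≤ c / 2 := min_le_left _ _
    have hc2 : c' ≤ 1 := min_le_right _ _
    have := count_int (a m) (b m) (d m) (c' * (1 / (1 + d m)) ^ N) hd (by positivity)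
      (by nlinarith) (by nlinarith [hlen m]) x hx1 hx2
    have h2 := mul_le_mul_of_nonneg_left this (show 0 ≤ 2 / c' by positivity)
    refine le_trans (le_of_eq ?_) h2
    have : 1 + d m ≠ 0 := by positivity
    rw [pow_add]
    field_simp

lemma openE (a b : ℕ → ℝ)
    (hdist : Tendsto (fun m => Metric.infDist (0 : ℝ) (Icc (a m) (b m))) atTop atTop)
    (E : Set ℝ) (hE : E = ⋃ m, Icc (a m) (b m)) : IsOpen (cplx E)ᶜ := by
  rw [isOpen_compl_iff]
  have h1 : IsClosed E := by
    rw [hE]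
    refine LocallyFinite.isClosed_iUnion (fun x => ?_) (fun m => isClosed_Icc)
    refine ⟨Metric.ball x 1, Metric.ball_mem_nhds x one_pos, ?_⟩
    obtain ⟨m0, hm0⟩ := eventually_atTop.1 (hdist.eventually_gt_atTop (|x| + 1))
    refine (finite_lt_nat m0).subset (fun m hm => ?_)
    by_contra hcon
    have h2 := hm0 m (not_lt.1 hcon)
    obtain ⟨y, hy1, hy2⟩ := hm
    have h3 := Metric.infDist_le_dist_of_mem (x := (0 : ℝ)) hy1
    rw [Real.dist_eq, zero_sub, abs_neg] at h3
    rw [Metric.mem_ball, Real.dist_eq] at hy2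
    have := abs_sub_abs_le_abs_sub y x
    linarith
  exact Complex.isometry_ofReal.isClosedEmbedding.isClosedMap E h1

theorem stmt5 (a b : ℕ → ℝ) (hab : ∀ m, a m < b m)
    (hdisj : ∀ m n, m ≠ n → Disjoint (Icc (a m) (b m)) (Icc (a n) (b n)))
    (hdist : Tendsto (fun m => Metric.infDist (0 : ℝ) (Icc (a m) (b m))) atTop atTop)
    (E : Set ℝ) (hE : E = ⋃ m, Icc (a m) (b m))
    (c M : ℝ) (hc : 0 < c)
    (hlen : ∀ m, c * (1 + Metric.infDist (0 : ℝ) (Icc (a m) (b m))) ^ (-M) ≤ b m - a m)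
    (f : ℂ → ℂ) (lam : ℕ → ℝ) (hf : KreinClass f lam)
    (hzeros : ∀ n, lam n ∈ E) :
    BoundedTypeOn f (cplx E)ᶜ := by

  have hO := openE a b hdist E hE
  obtain ⟨hfd, -, hfz, hfd0, hfs, hfk⟩ := hf
  set d : ℕ → ℝ := fun m => Metric.infDist (0 : ℝ) (Icc (a m) (b m)) with hd
  have hd0 : ∀ m, 0 ≤ d m := fun m => Metric.infDist_nonneg
  obtain ⟨N, hN⟩ := exists_nat_ge M
  have hlen' : ∀ m, c * (1 / (1 + d m)) ^ N ≤ b m - a m := by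
    intro m
    refine le_trans (mul_le_mul_of_nonneg_left ?_ hc.le) (hlen m)
    have h1 : (1 : ℝ) ≤ 1 + d m := by linarith [hd0 m]
    have h2 : (1 / (1 + d m)) ^ N = (1 + d m) ^ (-(N : ℝ)) := by
      rw [Real.rpow_neg (by linarith), Real.rpow_natCast, one_div, inv_pow]
    rw [h2]
    exact Real.rpow_le_rpow_of_exponent_le h1 (by linarith)
  have hcnt := counting a b hdisj d hd0 c N hc (fun m => by
    obtain ⟨x, hx, hx2⟩ := (isCompact_Icc (a := a m) (b := b m)).exists_infDist_eq_dist
      ⟨a m, le_rfl, (hab m).le⟩ (0 : ℝ)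
    refine ⟨x, hx, ?_⟩
    rw [Real.dist_eq, zero_sub, abs_neg] at hx2
    exact hx2.ge) hlen'
  obtain ⟨Ψ, hΨ, hΨ'⟩ := psi (a 0) (b 0) (hab 0)
  have hsub : (cplx E)ᶜ ⊆ (cplx (Icc (a 0) (b 0)))ᶜ := by
    refine compl_subset_compl.2 (image_mono ?_)
    rw [hE]; exact subset_iUnion (fun m => Icc (a m) (b m)) 0
  have hq0 : ∀ m, 0 < 1 / (1 + d m) := fun m => by have := hd0 m; positivity
  have hq1 : ∀ m, 1 / (1 + d m) ≤ 1 := fun m => by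
    have := hd0 m
    rw [div_le_one (by linarith)]; linarith
  have hcore := core a b hab E hE hO (fun m => 1 + d m)
    (fun m => (1 / (1 + d m)) ^ (N + 2 + N)) (fun m => by linarith [hd0 m])
    (fun m x hx => by
      have h3 := Metric.infDist_le_dist_of_mem (x := (0 : ℝ)) hx
      rw [Real.dist_eq, zero_sub, abs_neg] at h3
      simp only [hd]; linarith)
    (fun m => pow_pos (hq0 m) _)
    (Summable.of_nonneg_of_le (fun m => (pow_pos (hq0 m) _).le)
      (fun m => by
        rw [pow_add _ (N + 2)]
        exact mul_le_of_le_one_right (pow_pos (hq0 m) _).le (pow_le_one₀ (hq0 m).le (hq1 m))) hcnt)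
    (Summable.of_nonneg_of_le
      (fun m => by
        have h1 := hq0 m
        have h2 := hab m
        have h3 : 0 < b m - a m := by linarith
        positivity)
      (fun m => by
        have h1 := pow_pos (hq0 m) N
        have h2 := pow_pos (hq0 m) (N + 2)
        have h3 : 0 < b m - a m := by linarith [hab m]
        rw [pow_add _ (N + 2), mul_assoc]
        refine mul_le_mul_of_nonneg_left ?_ h2.le
        rw [mul_one_div, div_le_div_iff₀ h3 hc]
        have := hlen' m
        show _ ≤ 1 * _
        linarith) (hcnt.mul_right (1 / c)))
    (N + 2 + N) (fun m => by rw [one_div_pow, one_div_one_div])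
    Ψ (hΨ.mono hsub) (fun z hz => hΨ' z (hsub hz)) lam hzeros
  let e : ℕ → ℂ := fun n => 1 / deriv f (lam n)
  have hes : Summable (fun n => ‖e n‖) := by simpa [e] using hfs
  have hpos : ∀ u : ℕ → ℝ, (∀ n, u n ≤ ‖e n‖) → Summable (fun n => max (u n) 0) := fun u hu =>
    Summable.of_nonneg_of_le (fun n => le_max_right _ _)
      (fun n => max_le (hu n) (norm_nonneg _)) hes
  have hs1 := hpos (fun n => (e n).re) (fun n => Complex.re_le_norm _)
  have hs2 := hpos (fun n => -(e n).re) (fun n => (neg_le_abs _).trans (Complex.abs_re_le_norm _))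
  have hs3 := hpos (fun n => (e n).im) (fun n => Complex.im_le_norm _)
  have hs4 := hpos (fun n => -(e n).im) (fun n => (neg_le_abs _).trans (Complex.abs_im_le_norm _))
  obtain ⟨Q1, hQ1, hQ1'⟩ := hcore _ (fun n => le_max_right _ _) hs1
  obtain ⟨Q2, hQ2, hQ2'⟩ := hcore _ (fun n => le_max_right _ _) hs2
  obtain ⟨Q3, hQ3, hQ3'⟩ := hcore _ (fun n => le_max_right _ _) hs3
  obtain ⟨Q4, hQ4, hQ4'⟩ := hcore _ (fun n => le_max_right _ _) hs4
  have hfne : ∀ z ∈ (cplx E)ᶜ, f z ≠ 0 := by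
    intro z hz h0
    obtain ⟨n, rfl⟩ := (hfz z).1 h0
    exact hz ⟨lam n, hzeros n, rfl⟩
  -- the decomposition
  have hdec : ∀ z ∈ (cplx E)ᶜ, 1 / f z =
      (cau (fun n => max (e n).re 0) lam z - cau (fun n => max (-(e n).re) 0) lam z) +
      Complex.I * (cau (fun n => max (e n).im 0) lam z - cau (fun n => max (-(e n).im) 0) lam z) := by
    intro z hz
    obtain ⟨r, hr, hb⟩ := Metric.isOpen_iff.1 hO z hz
    have hrl : ∀ n, r ≤ ‖z - (lam n : ℂ)‖ := by
      intro n
      by_contra hcon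
      push Not at hcon
      have : (lam n : ℂ) ∈ Metric.ball z r := by
        rw [Metric.mem_ball, dist_comm, dist_eq_norm]; exact hcon
      exact hb this ⟨lam n, hzeros n, rfl⟩
    have H1 := (cau_summable _ lam (fun n => le_max_right _ _) hs1 hr hrl).of_norm.hasSum
    have H2 := (cau_summable _ lam (fun n => le_max_right _ _) hs2 hr hrl).of_norm.hasSum
    have H3 := (cau_summable _ lam (fun n => le_max_right _ _) hs3 hr hrl).of_norm.hasSum
    have H4 := (cau_summable _ lam (fun n => le_max_right _ _) hs4 hr hrl).of_norm.hasSum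
    have H := (H1.sub H2).add ((H3.sub H4).mul_left Complex.I)
    rw [(hfk z (hfne z hz)).2]
    refine Eq.trans (tsum_congr (fun n => ?_)) H.tsum_eq
    have hmax : ∀ x : ℝ, max x 0 - max (-x) 0 = x := by
      intro x
      rcases le_total x 0 with h | h
      · rw [max_eq_right h, max_eq_left (by linarith)]; ring
      · rw [max_eq_left h, max_eq_right (by linarith)]; ring
    have h1 : ((max (e n).re 0 : ℝ) : ℂ) - ((max (-(e n).re) 0 : ℝ) : ℂ) = ((e n).re : ℂ) := by
      rw [← Complex.ofReal_sub, hmax]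
    have h2 : ((max (e n).im 0 : ℝ) : ℂ) - ((max (-(e n).im) 0 : ℝ) : ℂ) = ((e n).im : ℂ) := by
      rw [← Complex.ofReal_sub, hmax]
    rw [← sub_div, ← sub_div, h1, h2, ← mul_div_assoc, ← add_div, mul_comm Complex.I,
      Complex.re_add_im]
    simp only [e]
    rw [div_div]
  let P : ℂ → ℂ := fun z => f z * (4 * (Q1 z * Q2 z * Q3 z * Q4 z))
  have hPd : DifferentiableOn ℂ P (cplx E)ᶜ :=
    hfd.differentiableOn.mul ((((hQ1.mul hQ2).mul hQ3).mul hQ4).const_mul 4)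
  have hPb : ∀ z ∈ (cplx E)ᶜ, 1 < ‖2 * P z‖ ∧ ‖f z‖ ≤ ‖2 * P z‖ := by
    intro z hz
    obtain ⟨a1, b1⟩ := hQ1' z hz
    obtain ⟨a2, b2⟩ := hQ2' z hz
    obtain ⟨a3, b3⟩ := hQ3' z hz
    obtain ⟨a4, b4⟩ := hQ4' z hz
    have hf0 : 0 < ‖f z‖ := norm_pos_iff.2 (hfne z hz)
    have hprod : ‖4 * (Q1 z * Q2 z * Q3 z * Q4 z)‖ = 4 * (‖Q1 z‖ * ‖Q2 z‖ * ‖Q3 z‖ * ‖Q4 z‖) := by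
      simp
    set q1 := ‖Q1 z‖
    set q2 := ‖Q2 z‖
    set q3 := ‖Q3 z‖
    set q4 := ‖Q4 z‖
    have m12 : 1 ≤ q1 * q2 := one_le_mul_of_one_le_of_one_le a1 a2
    have m34 : 1 ≤ q3 * q4 := one_le_mul_of_one_le_of_one_le a3 a4
    have hq : q1 * q2 * q3 * q4 = (q1 * q2) * (q3 * q4) := by ring
    have l12 : q1 * q2 ≤ q1 * q2 * q3 * q4 := by rw [hq]; exact le_mul_of_one_le_right (by linarith) m34
    have l34 : q3 * q4 ≤ q1 * q2 * q3 * q4 := by rw [hq]; exact le_mul_of_one_le_left (by linarith) m12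
    have e1 : q1 ≤ q1 * q2 := le_mul_of_one_le_right (by linarith) a2
    have e2 : q2 ≤ q1 * q2 := le_mul_of_one_le_left (by linarith) a1
    have e3 : q3 ≤ q3 * q4 := le_mul_of_one_le_right (by linarith) a4
    have e4 : q4 ≤ q3 * q4 := le_mul_of_one_le_left (by linarith) a3
    have hg : ‖1 / f z‖ ≤ 4 * (q1 * q2 * q3 * q4) := by
      rw [hdec z hz]
      refine (norm_add_le _ _).trans ?_
      rw [norm_mul, Complex.norm_I, one_mul]
      refine (add_le_add (norm_sub_le _ _) (norm_sub_le _ _)).trans ?_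
      linarith
    have hP : ‖2 * P z‖ = 2 * (‖f z‖ * (4 * (q1 * q2 * q3 * q4))) := by
      simp only [P]
      rw [norm_mul, norm_mul, hprod]; simp
    have hx1 : 1 ≤ ‖f z‖ * (4 * (q1 * q2 * q3 * q4)) := by
      rw [norm_div, norm_one, div_le_iff₀ hf0] at hg
      linarith
    have hx2 : ‖f z‖ ≤ ‖f z‖ * (4 * (q1 * q2 * q3 * q4)) :=
      le_mul_of_one_le_right hf0.le (by linarith)
    rw [hP]
    constructor <;> linarith
  refine ⟨fun z => Real.log ‖2 * P z‖, harm_log (fun z => 2 * P z) _ hO (hPd.const_mul 2) ?_, ?_, ?_⟩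
  · intro z hz h0
    have := (hPb z hz).1
    rw [h0, norm_zero] at this
    linarith
  · intro z hz
    exact Real.log_pos (hPb z hz).1
  · intro z hz
    refine max_le ?_ (Real.log_pos (hPb z hz).1).le
    exact Real.log_le_log (norm_pos_iff.2 (hfne z hz)) (hPb z hz).2
end

section
/- Let E = ⋃_m I_m, where I_m = [a_m, b_m] (a_m < b_m) are pairwise disjoint closed intervals in ℝ with dist(0, I_m) → ∞ as m → ∞. Let f be an entire function of the Krein class all of whose zeros lie in E, and suppose there are constants c > 0 and M < ∞ such that for every zero λ_n of f the interval I(λ_n) of E containing λ_n satisfies |I(λ_n)| ≥ c/((1 + |λ_n|^M)|f'(λ_n)|). Then f is of bounded type in ℂ∖E: there exists a positive harmonic function h on ℂ∖E with log⁺|f(z)| ≤ h(z) for all z ∈ ℂ∖E. -/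
open Complex Filter Set

lemma harmOn_of {h : ℂ → ℝ} {U : Set ℂ} (hU : IsOpen U)
    (H : InnerProductSpace.HarmonicOnNhd h U) : HarmonicOn h U := by
  refine ⟨H.contDiffOn, fun z hz => ?_⟩
  rw [iteratedFDerivWithin_of_isOpen 2 hU hz]
  have := (H z hz).2.self_of_nhds
  rw [InnerProductSpace.laplacian_eq_iteratedFDeriv_complexPlane] at this
  simpa using this

lemma quarter_sub {x y : ℝ} (hx : 0 ≤ x) (hy : 0 ≤ y) :
    (x + y) ^ (1/4 : ℝ) ≤ x ^ (1/4 : ℝ) + y ^ (1/4 : ℝ) :=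
  Real.rpow_add_le_add_rpow hx hy (by norm_num) (by norm_num)

lemma quarter_pow {x : ℝ} (hx : 0 ≤ x) : (x ^ (1/4 : ℝ)) ^ 4 = x := by
  rw [← Real.rpow_natCast, ← Real.rpow_mul hx]; norm_num

lemma re_quarter {w : ℂ} (hw : w ∈ slitPlane) :
    ‖w‖ ^ (1/4 : ℝ) ≤ 2 * (w ^ (1/4 : ℂ)).re := by
  have hw0 : w ≠ 0 := slitPlane_ne_zero hw
  have h1 : w ^ (1/4 : ℂ) = exp (((Real.log ‖w‖ * (1/4) : ℝ) : ℂ) + ((w.arg * (1/4) : ℝ) : ℂ) * I) := by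
    rw [cpow_def_of_ne_zero hw0, Complex.log]
    congr 1
    push_cast
    ring
  rw [h1, exp_re]
  have hn : 0 < ‖w‖ := norm_pos_iff.mpr hw0
  have h2 : (((Real.log ‖w‖ * (1/4) : ℝ) : ℂ) + ((w.arg * (1/4) : ℝ) : ℂ) * I).re = Real.log ‖w‖ * (1/4) := by
    simp
  have h3 : (((Real.log ‖w‖ * (1/4) : ℝ) : ℂ) + ((w.arg * (1/4) : ℝ) : ℂ) * I).im = w.arg * (1/4) := by
    simp
  rw [h2, h3, Real.rpow_def_of_pos hn]
  have hc : 1/2 ≤ Real.cos (w.arg * (1/4)) := by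
    rw [← Real.cos_abs, ← Real.cos_pi_div_three]
    have := abs_arg_le_pi w
    apply Real.cos_le_cos_of_nonneg_of_le_pi (abs_nonneg _)
    · linarith [Real.pi_pos]
    · rw [abs_mul, abs_of_pos (by norm_num : (0:ℝ) < 1/4)]
      linarith [Real.pi_pos]
  nlinarith [Real.exp_pos (Real.log ‖w‖ * (1/4))]

lemma norm_quarter (w : ℂ) : ‖w ^ (1/4 : ℂ)‖ = ‖w‖ ^ (1/4 : ℝ) := by
  have := Complex.norm_cpow_real w (1/4)
  simpa using this

lemma exists_q (a b l : ℝ) (hab : a < b) (hl : l ∈ Icc a b) :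
    ∃ q : ℂ → ℂ, ∀ z, z ∉ cplx (Icc a b) → DifferentiableAt ℂ q z ∧
      (‖z - l‖⁻¹) ^ (1/4 : ℝ) ≤ (q z).re ∧
      ‖q z‖ ≤ 3 * (2 / (b - a)) ^ (1/4 : ℝ) + 2 * (‖z - l‖⁻¹) ^ (1/4 : ℝ) := by
  set β : ℝ := 2 / (b - a) with hβ
  have hβ0 : 0 < β := by have : 0 < b - a := by linarith
                         positivity
  have hinv : β⁻¹ = (b - a) / 2 := by rw [hβ, inv_div]
  obtain ⟨σ, hσ, hslit⟩ : ∃ σ : ℂ, ‖σ‖ = 1 ∧ ∀ z, z ∉ cplx (Icc a b) →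
      (β : ℂ) + σ * (z - l)⁻¹ ∈ slitPlane := by
    rcases le_total ((b - a) / 2) (b - l) with h | h
    · refine ⟨-1, by simp, fun z hz => ?_⟩
      by_contra hn
      rw [mem_slitPlane_iff_not_le_zero, not_not] at hn
      apply hz
      obtain ⟨h1, h2⟩ := Complex.le_def.mp hn
      have e : (z - l)⁻¹ = (((z - l)⁻¹).re : ℂ) := by
        apply Complex.ext <;> simp at h2 ⊢
        first | linarith | simpa using h2
      set t := ((z - l)⁻¹).re with ht
      have h1' : β ≤ t := by
        rw [e] at h1
        simp at h1
        linarith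
      have ht0 : 0 < t := by linarith
      have e2 : z = ((l + t⁻¹ : ℝ) : ℂ) := by
        have : z - l = ((t⁻¹ : ℝ) : ℂ) := by
          rw [← inv_inv (z - (l:ℂ)), e]; push_cast; rfl
        push_cast
        rw [← ofReal_inv, ← this]; ring
      have h3 : t⁻¹ ≤ (b - a) / 2 := by rw [← hinv]; exact inv_anti₀ hβ0 h1'
      have h4 : 0 < t⁻¹ := by positivity
      exact ⟨l + t⁻¹, ⟨by linarith [hl.1], by linarith⟩, e2.symm⟩
    · refine ⟨1, by simp, fun z hz => ?_⟩
      by_contra hn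
      rw [mem_slitPlane_iff_not_le_zero, not_not] at hn
      apply hz
      obtain ⟨h1, h2⟩ := Complex.le_def.mp hn
      have e : (z - l)⁻¹ = (((z - l)⁻¹).re : ℂ) := by
        apply Complex.ext <;> simp at h2 ⊢
        first | linarith | simpa using h2
      set t := ((z - l)⁻¹).re with ht
      have h1' : β ≤ -t := by
        rw [e] at h1
        simp at h1
        linarith
      have ht0 : 0 < -t := by linarith
      have e2 : z = ((l + t⁻¹ : ℝ) : ℂ) := by
        have : z - l = ((t⁻¹ : ℝ) : ℂ) := by
          rw [← inv_inv (z - (l:ℂ)), e]; push_cast; rfl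
        push_cast
        rw [← ofReal_inv, ← this]; ring
      have h3 : (-t)⁻¹ ≤ (b - a) / 2 := by rw [← hinv]; exact inv_anti₀ hβ0 h1'
      have h4 : 0 < (-t)⁻¹ := by positivity
      rw [inv_neg] at h3 h4
      exact ⟨l + t⁻¹, ⟨by linarith, by linarith [hl.2]⟩, e2.symm⟩
  refine ⟨fun z => 2 * ((β : ℂ) + σ * (z - l)⁻¹) ^ (1/4 : ℂ) + ((β ^ (1/4 : ℝ) : ℝ) : ℂ), fun z hz => ?_⟩
  have hw := hslit z hz
  have hzl : z - l ≠ 0 := by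
    intro h
    exact hz ⟨l, hl, (sub_eq_zero.mp h).symm⟩
  have hb4 : 0 ≤ β ^ (1/4 : ℝ) := by positivity
  have hz4 : 0 ≤ (‖z - l‖⁻¹) ^ (1/4 : ℝ) := by positivity
  have hnn : ‖σ * (z - l)⁻¹‖ = ‖z - l‖⁻¹ := by rw [norm_mul, hσ, norm_inv, one_mul]
  refine ⟨?_, ?_, ?_⟩
  · have : DifferentiableAt ℂ (fun z : ℂ => (β : ℂ) + σ * (z - l)⁻¹) z := by
      fun_prop (disch := assumption)
    exact ((this.cpow_const hw).const_mul 2).add_const _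
  · have h1 := re_quarter hw
    have h2 : ‖z - l‖⁻¹ ≤ ‖(β : ℂ) + σ * (z - l)⁻¹‖ + β := by
      rw [← hnn]
      calc ‖σ * (z - l)⁻¹‖ = ‖((β : ℂ) + σ * (z - l)⁻¹) - β‖ := by congr 1; ring
        _ ≤ _ := (norm_sub_le _ _).trans (by simp [abs_of_pos hβ0])
    have h3 : (‖z - l‖⁻¹) ^ (1/4 : ℝ) ≤ ‖(β : ℂ) + σ * (z - l)⁻¹‖ ^ (1/4 : ℝ) + β ^ (1/4 : ℝ) :=
      (Real.rpow_le_rpow (by positivity) h2 (by norm_num)).trans (quarter_sub (norm_nonneg _) hβ0.le)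
    have h4 : (2 * ((β : ℂ) + σ * (z - l)⁻¹) ^ (1/4 : ℂ) + ((β ^ (1/4 : ℝ) : ℝ) : ℂ)).re
      = 2 * (((β : ℂ) + σ * (z - l)⁻¹) ^ (1/4 : ℂ)).re + β ^ (1/4 : ℝ) := by
      rw [add_re, ofReal_re]; simp
    simp only [h4]
    linarith
  · have h2 : ‖(β : ℂ) + σ * (z - l)⁻¹‖ ≤ β + ‖z - l‖⁻¹ := by
      refine (norm_add_le _ _).trans ?_
      rw [hnn]; simp [abs_of_pos hβ0]
    have h3 : ‖(β : ℂ) + σ * (z - l)⁻¹‖ ^ (1/4 : ℝ) ≤ β ^ (1/4 : ℝ) + (‖z - l‖⁻¹) ^ (1/4 : ℝ) :=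
      (Real.rpow_le_rpow (by positivity) h2 (by norm_num)).trans (quarter_sub hβ0.le (by positivity))
    refine (norm_add_le _ _).trans ?_
    rw [norm_mul, norm_quarter, norm_real, Real.norm_eq_abs, abs_of_nonneg hb4]
    simp only [norm_ofNat]
    linarith


lemma harnack {u : ℂ → ℝ} {c w : ℂ} {R : ℝ}
    (hu : InnerProductSpace.HarmonicOnNhd u (Metric.closedBall c R))
    (h0 : ∀ z ∈ Metric.closedBall c R, 0 ≤ u z) (hw : ‖w - c‖ < R) :
    (R - ‖w - c‖) * u w ≤ (R + ‖w - c‖) * u c ∧ (R - ‖w - c‖) * u c ≤ (R + ‖w - c‖) * u w := by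
  have hR : 0 < R := lt_of_le_of_lt (norm_nonneg _) hw
  have hwb : w ∈ Metric.ball c R := by rwa [Metric.mem_ball, dist_eq_norm]
  have hP := hu.circleAverage_poissonKernel_smul hwb
  have hM : Real.circleAverage u c R = u c := by
    apply InnerProductSpace.HarmonicOnNhd.circleAverage_eq
    rwa [abs_of_pos hR]
  have hci : ContinuousOn u (Metric.sphere c |R|) := by
    rw [abs_of_pos hR]
    exact hu.continuousOn.mono Metric.sphere_subset_closedBall
  have hk : ContinuousOn (poissonKernel c w) (Metric.sphere c |R|) := by
    rw [poissonKernel_eq_re_herglotzRieszKernel]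
    exact Complex.continuous_re.comp_continuousOn (continuousOn_herglotzRieszKernel_sphere hwb)
  have i1 : CircleIntegrable (poissonKernel c w • u) c R := (hk.smul hci).circleIntegrable'
  have hs : ∀ k : ℝ, Real.circleAverage (fun z => k * u z) c R = k * u c := by
    intro k
    rw [← hM]
    exact Real.circleAverage_fun_smul (a := k)
  have i2 : ∀ k : ℝ, CircleIntegrable (fun z => k * u z) c R := fun k =>
    (continuousOn_const.mul hci).circleIntegrable'
  have d1 : 0 < R - ‖w - c‖ := by linarith
  have d2 : 0 < R + ‖w - c‖ := by positivity
  constructor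
  · have := Real.circleAverage_mono i1 (i2 ((R + ‖w - c‖) / (R - ‖w - c‖))) (by
      intro x hx
      rw [abs_of_pos hR] at hx
      simp only [Pi.smul_apply', smul_eq_mul]
      apply mul_le_mul_of_nonneg_right _ (h0 x (Metric.sphere_subset_closedBall hx))
      rw [poissonKernel_eq_re_herglotzRieszKernel]
      exact re_herglotzRieszKernel_le hx hwb)
    rw [hP, hs, div_mul_eq_mul_div, le_div_iff₀ d1] at this
    linarith
  · have := Real.circleAverage_mono (i2 ((R - ‖w - c‖) / (R + ‖w - c‖))) i1 (by
      intro x hx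
      rw [abs_of_pos hR] at hx
      simp only [Pi.smul_apply', smul_eq_mul]
      apply mul_le_mul_of_nonneg_right _ (h0 x (Metric.sphere_subset_closedBall hx))
      rw [poissonKernel_eq_re_herglotzRieszKernel]
      exact le_re_herglotzRieszKernel hx hwb)
    rw [hP, hs, div_mul_eq_mul_div, div_le_iff₀ d2] at this
    linarith

/-- positivity of `log |f| - log m` on balls in the half-plane -/
lemma harnack_log {f : ℂ → ℂ} (hf : Differentiable ℂ f) {A : ℝ} (hA : 1 ≤ A)
    (hlow : ∀ z : ℂ, 0 < z.im → z.im ≤ A * ‖f z‖) {c w : ℂ} {η : ℝ} (hη : 0 < η)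
    (hw : ‖w - c‖ < c.im - η) :
    (c.im - η - ‖w - c‖) * (Real.log ‖f w‖ + Real.log (A / η)) ≤
      (c.im - η + ‖w - c‖) * (Real.log ‖f c‖ + Real.log (A / η)) ∧
    (c.im - η - ‖w - c‖) * (Real.log ‖f c‖ + Real.log (A / η)) ≤
      (c.im - η + ‖w - c‖) * (Real.log ‖f w‖ + Real.log (A / η)) ∧
    0 ≤ Real.log ‖f c‖ + Real.log (A / η) := by
  have him : ∀ z ∈ Metric.closedBall c (c.im - η), η ≤ z.im := by
    intro z hz
    rw [Metric.mem_closedBall, dist_eq_norm] at hz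
    have := (abs_im_le_norm (z - c)).trans hz
    rw [sub_im] at this
    linarith [neg_abs_le (z.im - c.im)]
  have hne : ∀ z ∈ Metric.closedBall c (c.im - η), 0 < ‖f z‖ := by
    intro z hz
    have h1 := him z hz
    have h2 := hlow z (by linarith)
    by_contra h
    nlinarith [norm_nonneg (f z)]
  have hpos : ∀ z ∈ Metric.closedBall c (c.im - η), 0 ≤ Real.log ‖f z‖ + Real.log (A / η) := by
    intro z hz
    have h1 := him z hz
    have h2 := hlow z (by linarith)
    have h3 := hne z hz
    rw [← Real.log_mul h3.ne' (by positivity)]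
    apply Real.log_nonneg
    rw [← mul_div_assoc, le_div_iff₀ hη]
    linarith
  have hh : InnerProductSpace.HarmonicOnNhd (fun z => Real.log ‖f z‖ + Real.log (A / η))
      (Metric.closedBall c (c.im - η)) := by
    intro z hz
    exact (AnalyticAt.harmonicAt_log_norm (hf.analyticAt z)
      (norm_pos_iff.mp (hne z hz))).add (InnerProductSpace.harmonicAt_const _)
  obtain ⟨h1, h2⟩ := harnack hh hpos hw
  exact ⟨h1, h2, hpos c (Metric.mem_closedBall_self (by linarith [norm_nonneg (w - c)]))⟩

lemma upper_half {f : ℂ → ℂ} (hf : Differentiable ℂ f) {A : ℝ} (hA : 1 ≤ A)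
    (hlow : ∀ z : ℂ, 0 < z.im → z.im ≤ A * ‖f z‖) :
    ∃ C : ℝ, 0 < C ∧ ∀ z : ℂ, 0 < z.im →
      Real.log ‖f z‖ ≤ C * (‖z‖ ^ 2 + 2) ^ 4 / z.im ^ 2 := by
  set U := Real.log ‖f I‖ + Real.log (A / (1/2)) with hU
  have hU0 : 0 ≤ U := by
    have := (harnack_log hf hA hlow (c := I) (w := I) (η := 1/2) (by norm_num) (by norm_num)).2.2
    exact this
  refine ⟨16 * U + 5, by linarith, fun z hz => ?_⟩
  set x := z.re with hx
  set y := z.im with hy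
  have hn : ‖z‖ ^ 2 = x ^ 2 + y ^ 2 := by
    rw [← normSq_eq_norm_sq, normSq_apply]; ring
  set T := ‖z‖ ^ 2 + 2 with hT
  have hT2 : 2 ≤ T := by rw [hT]; linarith [sq_nonneg ‖z‖]
  set c : ℂ := ⟨x, T⟩ with hc
  have hcim : c.im = T := rfl
  -- first comparison
  set d := ‖I - c‖ with hd
  have hd2 : d ^ 2 = x ^ 2 + (T - 1) ^ 2 := by
    rw [hd, ← normSq_eq_norm_sq, normSq_apply]; simp [hc]; ring
  have hd0 : 0 ≤ d := norm_nonneg _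
  have hdT : d < T - 1/2 := by
    apply lt_of_pow_lt_pow_left₀ 2 (by linarith)
    nlinarith [sq_nonneg y]
  have k1 := (harnack_log hf hA hlow (c := c) (w := I) (η := 1/2) (by norm_num)
    (by rw [hcim]; exact hdT)).2
  rw [hcim, ← hd, ← hU] at k1
  set W := Real.log ‖f c‖ with hW
  have k1' : W + Real.log (A / (1/2)) ≤ 4 * T ^ 2 * U := by
    have h1 : 1 ≤ (T - 1/2 + d) * (T - 1/2 - d) := by nlinarith [sq_nonneg y]
    have h2 := mul_le_mul_of_nonneg_left k1.1 (by linarith : 0 ≤ T - 1/2 + d)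
    have h3 : (T - 1/2 + d) * (T - 1/2 + d) ≤ 4 * T ^ 2 := by nlinarith
    have h4 := mul_le_mul_of_nonneg_right h3 hU0
    have h5 := mul_le_mul_of_nonneg_right h1 k1.2
    nlinarith
  -- second comparison
  have hyT : y ≤ T := by nlinarith [sq_nonneg x, sq_nonneg (y - 1)]
  have hzc : ‖z - c‖ = T - y := by
    have : z - c = ((-(T - y) : ℝ) : ℂ) * I := by
      apply Complex.ext <;> simp [hc, hx, hy]
    rw [this, norm_mul, norm_I, norm_real, Real.norm_eq_abs, abs_neg, abs_of_nonneg (by linarith)]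
    ring
  have k2 := harnack_log hf hA hlow (c := c) (w := z) (η := y / 2) (by linarith)
    (by rw [hcim, hzc]; linarith)
  rw [hcim, hzc, ← hW] at k2
  set L := Real.log ‖f z‖ with hL
  have hA0 : 0 < A := by linarith
  have hl1 : Real.log (A / (y / 2)) = Real.log (A / (1/2)) - Real.log y := by
    rw [← Real.log_div (by positivity) (by positivity)]
    congr 1; field_simp
  have hl2 : 0 ≤ Real.log (A / (1/2)) := Real.log_nonneg (by rw [le_div_iff₀ (by norm_num)]; linarith)
  have hl3 : Real.log y ≤ y := (Real.log_le_sub_one_of_pos hz).trans (by linarith)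
  have hl4 : - Real.log y ≤ 1 / y := by
    rw [← Real.log_inv, one_div]
    exact (Real.log_le_sub_one_of_pos (inv_pos.mpr hz)).trans (by linarith)
  obtain ⟨k2, -, k3⟩ := k2
  rw [hl1] at k2 k3
  set a := Real.log (A / (1/2))
  set V := W + (a - Real.log y) with hV
  have hV1 : y * V ≤ 4 * T ^ 2 * U * y + 1 := by
    have : V ≤ 4 * T ^ 2 * U + 1 / y := by linarith
    calc y * V ≤ y * (4 * T ^ 2 * U + 1 / y) := by gcongr
      _ = _ := by field_simp
  have hV2 : y / 2 * (L + (a - Real.log y)) ≤ 2 * T * V := by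
    have : (T - y / 2 + (T - y)) * V ≤ 2 * T * V := by
      apply mul_le_mul_of_nonneg_right _ k3; linarith
    have e : (T - y / 2 - (T - y)) = y / 2 := by ring
    rw [e] at k2
    linarith
  have hV3 : y * L ≤ 4 * T * V + y * y := by
    have q1 := mul_nonneg hz.le hl2
    have q2 := mul_le_mul_of_nonneg_left hl3 hz.le
    linear_combination 2 * hV2 + q1 + q2
  rw [le_div_iff₀ (by positivity)]
  have h6 : L * y ^ 2 ≤ 4 * T * (4 * T ^ 2 * U * y + 1) + y ^ 3 := by
    have : y * (y * L) ≤ y * (4 * T * V + y * y) := by gcongr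
    have h2 : 4 * T * (y * V) ≤ 4 * T * (4 * T ^ 2 * U * y + 1) := by gcongr
    linear_combination this + h2
  have h7 : y ^ 3 ≤ T ^ 3 := by gcongr
  have h8 : 16 * T ^ 3 * U * y ≤ 16 * T ^ 3 * U * T := by gcongr
  have h9 : 4 * T ≤ 4 * T ^ 4 := by
    have : T ^ 1 ≤ T ^ 4 := pow_le_pow_right₀ (by linarith) (by norm_num)
    linarith
  have h10 : T ^ 3 ≤ T ^ 4 := pow_le_pow_right₀ (by linarith) (by norm_num)
  linear_combination h6 + h7 + h8 + h9 + h10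


lemma re_inv_sq {p q : ℝ} (hp : 2 * |q| ≤ p) (hp0 : 0 < p) :
    12 / 25 / p ^ 2 ≤ (((⟨p, q⟩ : ℂ) ^ 2)⁻¹).re := by
  have h : (((⟨p, q⟩ : ℂ) ^ 2)⁻¹).re = (p ^ 2 - q ^ 2) / (p ^ 2 + q ^ 2) ^ 2 := by
    rw [inv_re]
    congr 1
    · simp [sq]
    · rw [map_pow, normSq_apply]; ring
  have hq : 4 * q ^ 2 ≤ p ^ 2 := by
    have : (2 * |q|) ^ 2 ≤ p ^ 2 := by gcongr
    rw [mul_pow, sq_abs] at this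
    linarith
  rw [h, div_div, div_le_div_iff₀ (by positivity) (by positivity)]
  have h1 : (p ^ 2 + q ^ 2) ^ 2 ≤ (5/4 * p ^ 2) ^ 2 := by gcongr; linarith
  have h2 : p ^ 2 * (3 / 4 * p ^ 2) ≤ p ^ 2 * (p ^ 2 - q ^ 2) := by gcongr; linarith
  linear_combination 12 * h1 + 25 * h2

def rhomb (R : ℝ) : Set ℂ := {z | |z.re| + 2 * |z.im| < R}

lemma rhomb_open (R : ℝ) : IsOpen (rhomb R) := by
  unfold rhomb
  exact isOpen_lt (by fun_prop) (by fun_prop)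

lemma rhomb_closure {R : ℝ} {z : ℂ} (h : z ∈ closure (rhomb R)) : |z.re| + 2 * |z.im| ≤ R := by
  have hc : IsClosed {z : ℂ | |z.re| + 2 * |z.im| ≤ R} :=
    isClosed_le (by fun_prop) (by fun_prop)
  have hs : rhomb R ⊆ {z : ℂ | |z.re| + 2 * |z.im| ≤ R} := fun w hw => by
    have hw' : |w.re| + 2 * |w.im| < R := hw
    exact hw'.le
  exact closure_minimal hs hc h

lemma rhomb_frontier {R : ℝ} {z : ℂ} (h : z ∈ frontier (rhomb R)) : |z.re| + 2 * |z.im| = R := by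
  rw [(rhomb_open R).frontier_eq] at h
  exact le_antisymm (rhomb_closure h.1) (not_lt.mp h.2)

lemma norm_le_rhomb {R : ℝ} {z : ℂ} (h : |z.re| + 2 * |z.im| ≤ R) : ‖z‖ ≤ R :=
  (norm_le_abs_re_add_abs_im z).trans (by linarith [abs_nonneg z.im])

lemma rhomb_corner {R : ℝ} {z : ℂ} (h : |z.re| + 2 * |z.im| ≤ R) (h1 : z ≠ R) :
    12 / 25 / (R - z.re) ^ 2 ≤ (((R - z) ^ 2)⁻¹).re ∧ 0 < R - z.re := by
  have hr := abs_le.mp (show |z.re| ≤ R by linarith [abs_nonneg z.im])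
  have p1 : 0 < R - z.re := by
    rcases (show 0 ≤ R - z.re by linarith).lt_or_eq with h' | h'
    · exact h'
    · exfalso; apply h1
      have h3 : |z.im| = 0 := by linarith [abs_nonneg z.im, le_abs_self z.re]
      apply Complex.ext
      · simp; linarith
      · simpa using h3
  refine ⟨?_, p1⟩
  have e : (R : ℂ) - z = ⟨R - z.re, -z.im⟩ := by apply Complex.ext <;> simp
  rw [e]; apply re_inv_sq _ p1
  rw [abs_neg]; linarith [le_abs_self z.re]

lemma tends_corner {g : ℂ → ℝ} {S : Set ℂ} {p : ℂ} {K : ℝ} (hK : 0 < K) (s : ℝ → ℝ)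
    (hs : Continuous s) (hs0 : s p.re = 0) (hpos : ∀ z ∈ S, 0 < s z.re)
    (hg : ∀ z ∈ S, K * (12 / 25 / (s z.re) ^ 2) ≤ g z) :
    Tendsto (fun z => Real.exp (-(g z))) (nhdsWithin p S) (nhds 0) := by
  apply Real.tendsto_exp_neg_atTop_nhds_zero.comp
  have h1 : Tendsto (fun z : ℂ => s z.re) (nhdsWithin p S) (nhdsWithin 0 (Ioi 0)) := by
    apply tendsto_nhdsWithin_of_tendsto_nhds_of_eventually_within
    · have : Continuous (fun z : ℂ => s z.re) := hs.comp continuous_re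
      have h := this.tendsto p
      simp only [hs0] at h
      exact h.mono_left nhdsWithin_le_nhds
    · filter_upwards [self_mem_nhdsWithin] with z hz using hpos z hz
  have h2 : Tendsto (fun t : ℝ => K * (12 / 25 / t ^ 2)) (nhdsWithin 0 (Ioi 0)) atTop := by
    have h3 : Tendsto (fun t : ℝ => (t⁻¹) ^ 2) (nhdsWithin 0 (Ioi 0)) atTop :=
      (tendsto_pow_atTop (by norm_num)).comp tendsto_inv_nhdsGT_zero
    have h4 := h3.const_mul_atTop (show 0 < K * (12/25) by positivity)
    refine h4.congr fun t => ?_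
    rw [inv_pow]; ring
  refine tendsto_atTop_mono' _ ?_ (h2.comp h1)
  filter_upwards [self_mem_nhdsWithin] with z hz using hg z hz

open Classical in
noncomputable def cor (R K : ℝ) (z : ℂ) : ℂ :=
  if z = R then 0 else exp (-(K * ((R - z) ^ 2)⁻¹))

lemma cor_norm {R K : ℝ} {z : ℂ} (h1 : z ≠ R) :
    ‖cor R K z‖ = Real.exp (-(K * (((R - z) ^ 2)⁻¹).re)) := by
  rw [cor, if_neg h1, norm_exp, neg_re, re_ofReal_mul]

lemma cor_diff {R K : ℝ} {z : ℂ} (h1 : z ≠ R) : DifferentiableAt ℂ (cor R K) z := by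
  have h2 : (R : ℂ) - z ≠ 0 := sub_ne_zero.mpr (Ne.symm h1)
  have h3 : ((R : ℂ) - z) ^ 2 ≠ 0 := pow_ne_zero 2 h2
  have : DifferentiableAt ℂ (fun z : ℂ => exp (-((K : ℂ) * ((R - z) ^ 2)⁻¹))) z := by
    fun_prop (disch := assumption)
  refine this.congr_of_eventuallyEq ?_
  filter_upwards [isOpen_ne.mem_nhds h1] with w hw
  rw [cor, if_neg hw]

lemma cor_bound {R K : ℝ} (hK : 0 < K) {z : ℂ} (h : |z.re| + 2 * |z.im| ≤ R) :
    ‖cor R K z‖ ≤ Real.exp (-(K * (12 / 25 / (R - z.re) ^ 2))) := by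
  by_cases h1 : z = R
  · rw [cor, if_pos h1]; simpa using (Real.exp_pos _).le
  · rw [cor_norm h1]
    have := (rhomb_corner h h1).1
    gcongr

lemma cor_cont {R K : ℝ} (hK : 0 < K) :
    ContinuousOn (cor R K) {z : ℂ | |z.re| + 2 * |z.im| ≤ R} := by
  intro z hz
  by_cases h1 : z = R
  · subst h1
    rw [← continuousWithinAt_sdiff_self]
    have h0 : cor R K R = 0 := by simp [cor]
    rw [ContinuousWithinAt, h0, tendsto_zero_iff_norm_tendsto_zero]
    have := tends_corner (g := fun z => K * (((R - z) ^ 2)⁻¹).re)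
      (S := {z : ℂ | |z.re| + 2 * |z.im| ≤ R} \ {(R : ℂ)}) (p := R) hK (fun t => R - t) (by fun_prop)
      (by simp) (fun z hz => (rhomb_corner hz.1 hz.2).2)
      (fun z hz => by have := (rhomb_corner hz.1 hz.2).1
                      exact mul_le_mul_of_nonneg_left this hK.le)
    refine this.congr' ?_
    filter_upwards [self_mem_nhdsWithin] with w hw
    rw [cor_norm hw.2]
  · exact (cor_diff h1).continuousAt.continuousWithinAt

lemma rhomb_max {f : ℂ → ℂ} (hf : Differentiable ℂ f) {C : ℝ} (hC : 0 < C)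
    (hb : ∀ z : ℂ, z.im ≠ 0 → Real.log ‖f z‖ ≤ C * (‖z‖ ^ 2 + 2) ^ 4 / z.im ^ 2)
    {R : ℝ} (hR : 1 ≤ R) {z : ℂ} (hz : ‖z‖ ≤ R / 4) :
    ‖f z‖ ≤ Real.exp (40 * (C * (R ^ 2 + 2) ^ 4)) := by
  set K0 := C * (R ^ 2 + 2) ^ 4 with hK0
  have hK0p : 0 < K0 := by positivity
  set K := 10 * K0 with hK
  have hKp : 0 < K := by positivity
  set D : Set ℂ := {z : ℂ | |z.re| + 2 * |z.im| ≤ R} with hD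
  have hDneg : ∀ w ∈ D, -w ∈ D := by
    intro w hw
    simpa [hD] using hw
  set F : ℂ → ℂ := fun w => f w * (cor R K w * cor R K (-w)) with hF
  have hmem : z ∈ rhomb R := by
    have h1 := (abs_re_le_norm z).trans hz
    have h2 := (abs_im_le_norm z).trans hz
    show |z.re| + 2 * |z.im| < R
    linarith
  have hdc : DiffContOnCl ℂ F (rhomb R) := by
    constructor
    · intro w hw
      have hw' : |w.re| + 2 * |w.im| < R := hw
      have h3 : |w.re| < R := by linarith [abs_nonneg w.im]
      have h1 : w ≠ R := by
        rintro rfl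
        rw [ofReal_re] at h3
        linarith [le_abs_self R]
      have h2 : -w ≠ R := by
        intro h
        rw [← abs_neg, ← neg_re, h, ofReal_re] at h3
        linarith [le_abs_self R]
      have h4 : DifferentiableAt ℂ (fun w => cor R K (-w)) w :=
        (cor_diff h2).comp w differentiableAt_id.neg
      exact ((hf w).mul ((cor_diff h1).mul h4)).differentiableWithinAt
    · have : ContinuousOn F D := by
        refine hf.continuous.continuousOn.mul ((cor_cont hKp).mul ?_)
        exact (cor_cont hKp).comp continuous_neg.continuousOn hDneg
      exact this.mono fun w hw => rhomb_closure hw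
  have hbd : Bornology.IsBounded (rhomb R) := by
    refine (Metric.isBounded_closedBall (x := (0:ℂ)) (r := R)).subset fun w hw => ?_
    rw [mem_closedBall_zero_iff]
    exact norm_le_rhomb (le_of_lt hw)
  have hfr : ∀ w ∈ frontier (rhomb R), ‖F w‖ ≤ 1 := by
    intro w hw
    have he := rhomb_frontier hw
    have hwD : w ∈ D := he.le
    by_cases hi : w.im = 0
    · rw [hi] at he
      simp only [abs_zero, mul_zero, add_zero] at he
      have hF0 : F w = 0 := by
        rcases (abs_eq (by linarith)).mp he with h | h
        · have : w = R := by apply Complex.ext <;> simp [h, hi]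
          simp [hF, cor, this]
        · have : -w = R := by apply Complex.ext <;> simp [h, hi]
          simp [hF, cor, this]
      rw [hF0]; simp
    · by_cases hf0 : f w = 0
      · simp [hF, hf0]
      have b1 : ‖f w‖ ≤ Real.exp (K0 / w.im ^ 2) := by
        rw [← Real.log_le_iff_le_exp (norm_pos_iff.mpr hf0)]
        refine (hb w hi).trans ?_
        rw [hK0]
        have := norm_le_rhomb he.le
        gcongr
      have hi2 : 0 < w.im ^ 2 := by positivity
      have c1 := cor_bound hKp hwD
      have c2 := cor_bound hKp (hDneg w hwD)
      have key : ‖cor R K w‖ * ‖cor R K (-w)‖ ≤ Real.exp (-(K0 / w.im ^ 2)) := by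
        have aux : K0 / w.im ^ 2 ≤ K * (12 / 25 / (2 * |w.im|) ^ 2) := by
          rw [mul_pow, sq_abs, hK]
          have : 10 * K0 * (12 / 25 / (2 ^ 2 * w.im ^ 2)) = 1.2 * (K0 / w.im ^ 2) := by
            field_simp; norm_num
          rw [this]
          have : 0 ≤ K0 / w.im ^ 2 := by positivity
          linarith
        have one : ∀ v ∈ D, ‖cor R K v‖ ≤ 1 := fun v hv => (cor_bound hKp hv).trans (by
          rw [Real.exp_le_one_iff]
          have : 0 ≤ K * (12 / 25 / (R - v.re) ^ 2) := by positivity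
          linarith)
        rcases le_total 0 w.re with h | h
        · rw [abs_of_nonneg h] at he
          have : R - w.re = 2 * |w.im| := by linarith
          rw [this] at c1
          calc _ ≤ Real.exp (-(K * (12 / 25 / (2 * |w.im|) ^ 2))) * 1 := by
                gcongr; exact one _ (hDneg w hwD)
            _ ≤ _ := by rw [mul_one]; gcongr
        · rw [abs_of_nonpos h] at he
          have : R - (-w).re = 2 * |w.im| := by rw [neg_re]; linarith
          rw [this] at c2
          calc _ ≤ 1 * Real.exp (-(K * (12 / 25 / (2 * |w.im|) ^ 2))) := by
                gcongr; exact one _ hwD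
            _ ≤ _ := by rw [one_mul]; gcongr
      calc ‖F w‖ = ‖f w‖ * (‖cor R K w‖ * ‖cor R K (-w)‖) := by simp [hF]
        _ ≤ Real.exp (K0 / w.im ^ 2) * Real.exp (-(K0 / w.im ^ 2)) := by gcongr
        _ = 1 := by rw [← Real.exp_add]; simp
  have hmax := norm_le_of_forall_mem_frontier_norm_le hbd hdc hfr (subset_closure hmem)
  have low : ∀ v : ℂ, ‖v‖ ≤ R / 4 → Real.exp (-(2 * K)) ≤ ‖cor R K v‖ := by
    intro v hv
    have h1 : v ≠ R := by
      rintro rfl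
      rw [norm_real, Real.norm_eq_abs] at hv
      linarith [le_abs_self R]
    rw [cor_norm h1]
    have h2 : (3 / 4 : ℝ) ≤ ‖(R : ℂ) - v‖ := by
      have := norm_sub_norm_le (R : ℂ) v
      rw [norm_real, Real.norm_eq_abs, abs_of_pos (by linarith)] at this
      linarith
    have h3 : (((R - v) ^ 2)⁻¹).re ≤ 2 := by
      refine (re_le_norm _).trans ?_
      rw [norm_inv, norm_pow, inv_le_comm₀ (by positivity) (by norm_num)]
      nlinarith
    apply Real.exp_le_exp.mpr
    nlinarith
  have l1 := low z hz
  have l2 := low (-z) (by rwa [norm_neg])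
  have l3 : Real.exp (-(4 * K)) ≤ ‖cor R K z‖ * ‖cor R K (-z)‖ := by
    calc Real.exp (-(4 * K)) = Real.exp (-(2 * K)) * Real.exp (-(2 * K)) := by
          rw [← Real.exp_add]; congr 1; ring
      _ ≤ _ := by gcongr
  have l4 : ‖f z‖ * Real.exp (-(4 * K)) ≤ 1 := by
    refine le_trans ?_ hmax
    simp only [hF, norm_mul]
    gcongr
  have e : 40 * K0 = 4 * K := by rw [hK]; ring
  rw [e]
  rw [Real.exp_neg, ← div_eq_mul_inv, div_le_one (Real.exp_pos _)] at l4
  exact l4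

lemma finite_order {f : ℂ → ℂ} (hf : Differentiable ℂ f) {A : ℝ} (hA : 1 ≤ A)
    (hlow : ∀ z : ℂ, z.im ≠ 0 → |z.im| ≤ A * ‖f z‖) :
    ∃ C : ℝ, 0 < C ∧ ∀ r : ℝ, ∀ z : ℂ, ‖z‖ ≤ r → ‖f z‖ ≤ Real.exp (C * (1 + r) ^ 16) := by
  obtain ⟨C1, hC1, h1⟩ := upper_half hf hA (fun z hz => by
    have := hlow z hz.ne'
    rwa [abs_of_pos hz] at this)
  obtain ⟨C2, hC2, h2⟩ := upper_half (f := fun z => f (-z)) (hf.comp differentiable_neg) hA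
    (fun z hz => by
      have := hlow (-z) (by simpa using hz.ne')
      rwa [neg_im, abs_neg, abs_of_pos hz] at this)
  have hb : ∀ z : ℂ, z.im ≠ 0 → Real.log ‖f z‖ ≤ (C1 + C2) * (‖z‖ ^ 2 + 2) ^ 4 / z.im ^ 2 := by
    intro z hz
    rcases lt_or_gt_of_ne hz with h | h
    · have := h2 (-z) (by simpa using h)
      simp only [neg_neg, norm_neg, neg_im, even_two, Even.neg_pow] at this
      refine this.trans ?_
      gcongr; linarith
    · refine (h1 z h).trans ?_
      gcongr; linarith
  refine ⟨40 * (C1 + C2) * 18 ^ 4, by positivity, fun r z hz => ?_⟩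
  have hr : 0 ≤ r := (norm_nonneg z).trans hz
  refine (rhomb_max hf (by positivity) hb (R := 4 * r + 1) (by linarith) (by linarith)).trans ?_
  apply Real.exp_le_exp.mpr
  have a1 : (4 * r + 1) ^ 2 + 2 ≤ 18 * (1 + r) ^ 2 := by nlinarith
  have a2 : ((4 * r + 1) ^ 2 + 2) ^ 4 ≤ (18 * (1 + r) ^ 2) ^ 4 := by gcongr
  have a3 : (18 * (1 + r) ^ 2) ^ 4 ≤ 18 ^ 4 * (1 + r) ^ 16 := by
    rw [mul_pow, ← pow_mul]
    gcongr
    · linarith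
    · norm_num
  calc 40 * ((C1 + C2) * ((4 * r + 1) ^ 2 + 2) ^ 4)
      ≤ 40 * ((C1 + C2) * (18 ^ 4 * (1 + r) ^ 16)) := by gcongr; exact a2.trans a3
    _ = _ := by ring


lemma count {f : ℂ → ℂ} (hf : Differentiable ℂ f) {lam : ℕ → ℝ} (hinj : Function.Injective lam)
    (hz : ∀ n, f (lam n) = 0) (hI : f I ≠ 0) {C : ℝ} (hC : 0 < C)
    (hb : ∀ r : ℝ, ∀ z : ℂ, ‖z‖ ≤ r → ‖f z‖ ≤ Real.exp (C * (1 + r) ^ 16)) :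
    ∃ C' : ℝ, 0 < C' ∧ ∀ (R : ℝ) (s : Finset ℕ), 0 ≤ R → (∀ n ∈ s, |lam n| ≤ R) →
      (s.card : ℝ) ≤ C' * (1 + R) ^ 16 := by
  refine ⟨C * 5 ^ 16 + |Real.log ‖f I‖|, by positivity, fun R s hR hs => ?_⟩
  set r := R + 1 with hr
  have hrp : 0 < r := by linarith
  set M := Real.exp (C * (1 + (3 * r + 1)) ^ 16) with hM
  have hM1 : 1 ≤ M := Real.one_le_exp (by positivity)
  have han : ∀ S : Set ℂ, AnalyticOnNhd ℂ f S := fun S z _ => hf.analyticAt z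
  have key := AnalyticOnNhd.sum_divisor_le (f := f) (c := I) (r := r) (R := 3 * r) (M := M)
    (by positivity) (by rw [abs_of_pos hrp, abs_of_pos (by positivity)]; linarith) hM1
    (han _) hI (by
      intro z hz
      apply hb
      rw [abs_of_pos (by positivity), mem_sphere_iff_norm] at hz
      have := norm_add_le (z - I) I
      rw [sub_add_cancel, norm_I, hz] at this
      exact this)
  rw [abs_of_pos hrp] at key
  set dv := MeromorphicOn.divisor f (Metric.closedBall I r) with hdv
  have hnn : ∀ u, 0 ≤ dv u := fun u => MeromorphicOn.AnalyticOnNhd.divisor_nonneg (han _) u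
  have hfin : (Function.support dv).Finite := dv.finiteSupport (isCompact_closedBall _ _)
  have h1 : ∀ n ∈ s, 1 ≤ dv (lam n) := by
    intro n hn
    have hmem : (lam n : ℂ) ∈ Metric.closedBall I r := by
      rw [mem_closedBall_iff_norm]
      refine (norm_sub_le _ _).trans ?_
      rw [norm_I, norm_real, Real.norm_eq_abs]
      linarith [hs n hn]
    have hord0 : analyticOrderAt f (lam n) ≠ 0 := by
      rw [Ne, (hf.analyticAt _).analyticOrderAt_eq_zero]
      simp [hz n]
    have hordt : analyticOrderAt f (lam n) ≠ ⊤ := by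
      intro h
      rw [analyticOrderAt_eq_top] at h
      have := (han univ).eqOn_zero_of_preconnected_of_eventuallyEq_zero isPreconnected_univ
        (mem_univ _) h (mem_univ I)
      exact hI this
    rw [hdv, MeromorphicOn.AnalyticOnNhd.divisor_apply (han _) hmem]
    obtain ⟨k, hk⟩ := ENat.ne_top_iff_exists.mp hordt
    rw [← hk] at hord0 ⊢
    have hk0 : k ≠ 0 := by simpa using hord0
    have : ((((k : ℕ∞)).map (fun x : ℕ => (x : ℤ)) : WithTop ℤ)).untop₀ = (k : ℤ) := by
      rfl
    simp only [this] 
    omega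
  have h2 : (s.card : ℤ) ≤ ∑ᶠ u, dv u := by
    set e : ℕ → ℂ := fun n => (lam n : ℂ) with he
    have hei : Function.Injective e := fun m n h => hinj (Complex.ofReal_injective h)
    rw [finsum_eq_sum_of_support_subset (s := hfin.toFinset ∪ s.image e) dv (by
      intro u hu
      simp only [Finset.coe_union, Finite.coe_toFinset]
      exact Or.inl hu)]
    calc (s.card : ℤ) = ∑ n ∈ s, 1 := by simp
      _ ≤ ∑ n ∈ s, dv (e n) := Finset.sum_le_sum h1
      _ = ∑ u ∈ s.image e, dv u := by rw [Finset.sum_image (fun a _ b _ h => hei h)]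
      _ ≤ _ := Finset.sum_le_sum_of_subset_of_nonneg Finset.subset_union_right
          (fun u _ _ => hnn u)
  have h3 : (s.card : ℝ) ≤ Real.log (M / ‖f I‖) / Real.log (3 * r / r) := by
    refine le_trans ?_ key
    exact_mod_cast h2
  have hlog3 : 1 ≤ Real.log (3 * r / r) := by
    rw [mul_div_assoc, div_self hrp.ne', mul_one, Real.le_log_iff_exp_le (by norm_num)]
    linarith [Real.exp_one_lt_d9]
  have h4 : Real.log (M / ‖f I‖) ≤ C * (1 + (3 * r + 1)) ^ 16 + |Real.log ‖f I‖| := by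
    rw [Real.log_div (Real.exp_pos _).ne' (norm_ne_zero_iff.mpr hI), Real.log_exp]
    linarith [neg_abs_le (Real.log ‖f I‖)]
  have h5 : Real.log (M / ‖f I‖) / Real.log (3 * r / r) ≤
      C * (1 + (3 * r + 1)) ^ 16 + |Real.log ‖f I‖| := by
    rw [div_le_iff₀ (by linarith)]
    refine h4.trans ?_
    apply le_mul_of_one_le_right (by positivity) hlog3
  have h6 : C * (1 + (3 * r + 1)) ^ 16 ≤ C * 5 ^ 16 * (1 + R) ^ 16 := by
    rw [mul_assoc, ← mul_pow]
    gcongr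
    rw [hr]; linarith
  have h7 : |Real.log ‖f I‖| ≤ |Real.log ‖f I‖| * (1 + R) ^ 16 :=
    le_mul_of_one_le_right (abs_nonneg _) (one_le_pow₀ (by linarith))
  rw [add_mul]
  linarith

lemma summ_of_count {lam : ℕ → ℝ} {C' : ℝ} (hC : 0 < C')
    (h : ∀ (R : ℝ) (s : Finset ℕ), 0 ≤ R → (∀ n ∈ s, |lam n| ≤ R) →
      (s.card : ℝ) ≤ C' * (1 + R) ^ 16) :
    Summable (fun n => ((1 + |lam n|) ^ 18)⁻¹) := by
  have hs0 : Summable (fun j : ℕ => C' * 2 ^ 16 * (1 / ((j : ℝ) + 1) ^ 2)) := by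
    apply Summable.mul_left
    have := (summable_nat_add_iff 1).mpr (Real.summable_one_div_nat_pow.mpr (by norm_num : 1 < 2))
    simpa using this
  apply summable_of_sum_le (c := ∑' j : ℕ, C' * 2 ^ 16 * (1 / ((j : ℝ) + 1) ^ 2))
  · intro n; positivity
  · intro s
    set fl : ℕ → ℕ := fun n => ⌊|lam n|⌋₊ with hfl
    rw [← Finset.sum_fiberwise_of_maps_to (g := fl) (t := s.image fl)
      (fun n hn => Finset.mem_image_of_mem _ hn)]
    refine le_trans (Finset.sum_le_sum fun j _ => ?_) (hs0.sum_le_tsum (s.image fl) (fun j _ => by positivity))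
    have hc := h (j + 1) (s.filter (fun n => fl n = j)) (by positivity) (by
      intro n hn
      rw [Finset.mem_filter] at hn
      rw [← hn.2]
      exact (Nat.lt_floor_add_one _).le)
    have ht : ∀ n ∈ s.filter (fun n => fl n = j), ((1 + |lam n|) ^ 18)⁻¹ ≤ (((j : ℝ) + 1) ^ 18)⁻¹ := by
      intro n hn
      rw [Finset.mem_filter] at hn
      have : (j : ℝ) ≤ |lam n| := by rw [← hn.2]; exact Nat.floor_le (abs_nonneg _)
      apply inv_anti₀ (by positivity)
      apply pow_le_pow_left₀ (by positivity)
      linarith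
    refine (Finset.sum_le_card_nsmul _ _ _ ht).trans ?_
    rw [nsmul_eq_mul]
    have hj : (1 + ((j : ℝ) + 1)) ≤ 2 * ((j : ℝ) + 1) := by linarith [(Nat.cast_nonneg j : (0:ℝ) ≤ j)]
    calc ((s.filter (fun n => fl n = j)).card : ℝ) * (((j : ℝ) + 1) ^ 18)⁻¹
        ≤ (C' * (1 + ((j : ℝ) + 1)) ^ 16) * (((j : ℝ) + 1) ^ 18)⁻¹ := by gcongr
      _ ≤ (C' * (2 * ((j : ℝ) + 1)) ^ 16) * (((j : ℝ) + 1) ^ 18)⁻¹ := by gcongr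
      _ = _ := by field_simp

lemma krein_low {f : ℂ → ℂ} {lam : ℕ → ℝ} (hf : KreinClass f lam) :
    ∃ A : ℝ, 1 ≤ A ∧ ∀ z : ℂ, z.im ≠ 0 → |z.im| ≤ A * ‖f z‖ := by
  obtain ⟨hd, hinj, hz, hd0, hs, hrep⟩ := hf
  refine ⟨1 + ∑' n, 1 / ‖deriv f (lam n)‖, ?_, fun z hzi => ?_⟩
  · have : 0 ≤ ∑' n, 1 / ‖deriv f (lam n)‖ := tsum_nonneg fun n => by positivity
    linarith
  have hfz : f z ≠ 0 := by
    intro h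
    obtain ⟨n, rfl⟩ := (hz z).mp h
    simp at hzi
  obtain ⟨h1, h2⟩ := hrep z hfz
  have hp : 0 < |z.im| := abs_pos.mpr hzi
  have h3 : ‖1 / f z‖ ≤ (∑' n, 1 / ‖deriv f (lam n)‖) / |z.im| := by
    rw [h2, ← tsum_div_const]
    refine (norm_tsum_le_tsum_norm h1).trans (h1.tsum_le_tsum (fun n => ?_) (hs.div_const _))
    rw [norm_div, norm_one, norm_mul, div_div]
    have hdp : 0 < ‖deriv f (lam n)‖ := norm_pos_iff.mpr (hd0 n)
    have : |z.im| ≤ ‖z - lam n‖ := by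
      have := abs_im_le_norm (z - lam n)
      simpa using this
    gcongr
  have hfp : 0 < ‖f z‖ := norm_pos_iff.mpr hfz
  rw [norm_div, norm_one, div_le_div_iff₀ hfp hp] at h3
  linarith

lemma krein_summ {f : ℂ → ℂ} {lam : ℕ → ℝ} (hf : KreinClass f lam) :
    Summable (fun n => ((1 + |lam n|) ^ 18)⁻¹) := by
  obtain ⟨A, hA, hlow⟩ := krein_low hf
  obtain ⟨hd, hinj, hz, -⟩ := hf
  obtain ⟨C, hC, hb⟩ := finite_order hd hA hlow
  have hI : f I ≠ 0 := by
    intro h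
    have := hlow I (by simp)
    rw [h] at this
    norm_num at this
  obtain ⟨C', hC', hcnt⟩ := count hd hinj (fun n => (hz _).mpr ⟨n, rfl⟩) hI hC hb
  exact summ_of_count hC' hcnt

lemma quarter_le {x : ℝ} (hx : 0 ≤ x) : x ^ (1/4:ℝ) ≤ 1 + x := by
  have h := quarter_pow hx
  have h0 : 0 ≤ x ^ (1/4:ℝ) := Real.rpow_nonneg hx _
  set y := x ^ (1/4:ℝ)
  rw [← h]
  nlinarith [sq_nonneg (y ^ 2 - 1/2), sq_nonneg (y - 1/2)]

lemma weights {lam cc β : ℕ → ℝ} (hcc : ∀ n, 0 ≤ cc n) (hβ : ∀ n, 0 ≤ β n) (hs : Summable cc)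
    (hl : Summable (fun n => ((1 + |lam n|) ^ 18)⁻¹)) {B M : ℝ} (hB : 0 ≤ B)
    (hcb : ∀ n, cc n * β n ≤ B * (1 + |lam n| ^ M)) :
    ∃ K : ℕ, Summable (fun n => cc n ^ (1/4:ℝ) * ((1 + |lam n|) ^ K)⁻¹) ∧
      Summable (fun n => cc n ^ (1/4:ℝ) * ((1 + |lam n|) ^ K)⁻¹ * β n ^ (1/4:ℝ)) := by
  obtain ⟨m, hm⟩ := exists_nat_ge M
  have h1 : ∀ᶠ n in atTop, 1 ≤ |lam n| := by
    have := hl.tendsto_atTop_zero.eventually (gt_mem_nhds (show (0:ℝ) < ((2:ℝ) ^ 18)⁻¹ by positivity))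
    filter_upwards [this] with n hn
    by_contra hlt
    push Not at hlt
    have h3 : ((2:ℝ) ^ 18)⁻¹ ≤ ((1 + |lam n|) ^ 18)⁻¹ := by
      apply inv_anti₀ (by positivity)
      apply pow_le_pow_left₀ (by positivity)
      linarith
    linarith
  have h2 : ∀ᶠ n in atTop, cc n < 1 := hs.tendsto_atTop_zero.eventually (gt_mem_nhds one_pos)
  refine ⟨m + 18, ?_, ?_⟩
  · apply Summable.of_norm_bounded_eventually_nat hl
    filter_upwards [h2] with n hn
    rw [Real.norm_of_nonneg (by have := hcc n; positivity)]
    have h3 : cc n ^ (1/4:ℝ) ≤ 1 := Real.rpow_le_one (hcc n) hn.le (by norm_num)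
    have h4 : ((1 + |lam n|) ^ (m + 18))⁻¹ ≤ ((1 + |lam n|) ^ 18)⁻¹ := by
      apply inv_anti₀ (by positivity)
      apply pow_le_pow_right₀ (by linarith [abs_nonneg (lam n)])
      omega
    calc _ ≤ 1 * ((1 + |lam n|) ^ 18)⁻¹ := by gcongr
      _ = _ := one_mul _
  · apply Summable.of_norm_bounded_eventually_nat (hl.mul_left (1 + B * 2))
    filter_upwards [h1] with n hn
    rw [Real.norm_of_nonneg (by have := hcc n; have := hβ n; positivity)]
    have h3 : cc n ^ (1/4:ℝ) * β n ^ (1/4:ℝ) ≤ (1 + B * 2) * (1 + |lam n|) ^ m := by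
      rw [← Real.mul_rpow (hcc n) (hβ n)]
      refine (quarter_le (mul_nonneg (hcc n) (hβ n))).trans ?_
      have h5 : 1 ≤ (1 + |lam n|) ^ m := one_le_pow₀ (by linarith)
      have h6 : |lam n| ^ M ≤ (1 + |lam n|) ^ m := by
        calc |lam n| ^ M ≤ |lam n| ^ (m:ℝ) := Real.rpow_le_rpow_of_exponent_le hn hm
          _ = |lam n| ^ m := Real.rpow_natCast _ _
          _ ≤ _ := pow_le_pow_left₀ (abs_nonneg _) (by linarith) _
      have h7 := hcb n
      have h8 : B * (1 + |lam n| ^ M) ≤ B * (2 * (1 + |lam n|) ^ m) := by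
        apply mul_le_mul_of_nonneg_left _ hB
        linarith
      linarith
    calc _ = cc n ^ (1/4:ℝ) * β n ^ (1/4:ℝ) * ((1 + |lam n|) ^ (m + 18))⁻¹ := by ring
      _ ≤ (1 + B * 2) * (1 + |lam n|) ^ m * ((1 + |lam n|) ^ (m + 18))⁻¹ := by gcongr
      _ = _ := by
        have : 0 < 1 + |lam n| := by positivity
        rw [pow_add]; field_simp

lemma inv_bd (z : ℂ) (l : ℝ) (N : ℕ) :
    ‖z - l‖⁻¹ ≤ 1 + (2 + 2 * ‖z‖) ^ N * (((1 + |l|) ^ N)⁻¹ * ‖z - l‖⁻¹) := by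
  have hi : 0 ≤ ‖z - l‖⁻¹ := by positivity
  by_cases h : |l| ≤ 2 * ‖z‖ + 1
  · have h1 : (1 + |l|) ^ N ≤ (2 + 2 * ‖z‖) ^ N := pow_le_pow_left₀ (by positivity) (by linarith) _
    have h2 : 1 ≤ (2 + 2 * ‖z‖) ^ N * ((1 + |l|) ^ N)⁻¹ := by
      rw [← div_eq_mul_inv, one_le_div (by positivity)]
      exact h1
    rw [← mul_assoc]
    have := le_mul_of_one_le_left hi h2
    linarith
  · push Not at h
    have h1 : 1 ≤ ‖z - l‖ := by
      have := norm_sub_norm_le (l:ℂ) z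
      rw [norm_real, Real.norm_eq_abs, norm_sub_rev] at this
      linarith [norm_nonneg z]
    have h2 : ‖z - l‖⁻¹ ≤ 1 := inv_le_one_of_one_le₀ h1
    have : 0 ≤ (2 + 2 * ‖z‖) ^ N * (((1 + |l|) ^ N)⁻¹ * ‖z - l‖⁻¹) := by positivity
    linarith

lemma sum_bd {lam cc : ℕ → ℝ} (hcc : ∀ n, 0 ≤ cc n) (hs : Summable cc) (z : ℂ) (K : ℕ)
    (ht : Summable (fun n => cc n ^ (1/4:ℝ) * ((1 + |lam n|) ^ K)⁻¹ * (‖z - lam n‖⁻¹) ^ (1/4:ℝ)))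
    (hz : Summable (fun n => cc n * ‖z - lam n‖⁻¹)) :
    ∑' n, cc n * ‖z - lam n‖⁻¹ ≤ ∑' n, cc n + (2 + 2 * ‖z‖) ^ (4 * K) *
      (∑' n, cc n ^ (1/4:ℝ) * ((1 + |lam n|) ^ K)⁻¹ * (‖z - lam n‖⁻¹) ^ (1/4:ℝ)) ^ 4 := by
  set t : ℕ → ℝ := fun n => cc n ^ (1/4:ℝ) * ((1 + |lam n|) ^ K)⁻¹ * (‖z - lam n‖⁻¹) ^ (1/4:ℝ) with htd
  have ht0 : ∀ n, 0 ≤ t n := fun n => by have := hcc n; simp only [htd]; positivity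
  set T := ∑' n, t n with hT
  have hT0 : 0 ≤ T := tsum_nonneg ht0
  have htT : ∀ n, t n ≤ T := fun n => ht.le_tsum n (fun j _ => ht0 j)
  have h4 : ∀ n, t n ^ 4 = cc n * (((1 + |lam n|) ^ (4 * K))⁻¹ * ‖z - lam n‖⁻¹) := by
    intro n
    simp only [htd]
    rw [mul_pow, mul_pow, quarter_pow (hcc n), quarter_pow (by positivity), inv_pow, ← pow_mul,
      mul_comm K 4]
    ring
  have hterm : ∀ n, cc n * ‖z - lam n‖⁻¹ ≤ cc n + (2 + 2 * ‖z‖) ^ (4 * K) * (T ^ 3 * t n) := by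
    intro n
    have h5 := mul_le_mul_of_nonneg_left (inv_bd z (lam n) (4 * K)) (hcc n)
    have h6 : t n ^ 4 ≤ T ^ 3 * t n := by
      rw [pow_succ]
      exact mul_le_mul_of_nonneg_right (pow_le_pow_left₀ (ht0 n) (htT n) 3) (ht0 n)
    have h7 : (2 + 2 * ‖z‖) ^ (4 * K) * t n ^ 4 ≤ (2 + 2 * ‖z‖) ^ (4 * K) * (T ^ 3 * t n) := by
      gcongr
    rw [h4] at h7
    linarith
  have hsr : Summable (fun n => (2 + 2 * ‖z‖) ^ (4 * K) * (T ^ 3 * t n)) :=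
    (ht.mul_left _).mul_left _
  calc _ ≤ ∑' n, (cc n + (2 + 2 * ‖z‖) ^ (4 * K) * (T ^ 3 * t n)) :=
        hz.tsum_le_tsum hterm (hs.add hsr)
    _ = _ := by
      rw [hs.tsum_add hsr, tsum_mul_left, tsum_mul_left, ← hT]
      ring

lemma log_bd (z : ℂ) (a0 : ℝ) (hz : z ≠ a0) {u : ℝ} (hu : (‖z - a0‖⁻¹) ^ (1/4:ℝ) ≤ u) :
    Real.log (2 + 2 * ‖z‖) ≤ Real.log 2 + Real.log ‖z - a0‖ + 4 * ((1 + |a0|) * u) := by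
  have hp : 0 < ‖z - a0‖ := norm_pos_iff.mpr (sub_ne_zero.mpr hz)
  set v := (‖z - a0‖⁻¹) ^ (1/4:ℝ) with hv
  have hv0 : 0 ≤ v := by positivity
  have hv4 : v ^ 4 = ‖z - a0‖⁻¹ := quarter_pow (by positivity)
  set C := 1 + |a0| with hC
  have hC1 : 1 ≤ C := by linarith [abs_nonneg a0]
  have h1 : 2 + 2 * ‖z‖ ≤ 2 * (‖z - a0‖ * (1 + C * v) ^ 4) := by
    have h2 : ‖z‖ ≤ ‖z - a0‖ + |a0| := by
      have := norm_add_le (z - a0) (a0:ℂ)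
      rwa [sub_add_cancel, norm_real, Real.norm_eq_abs] at this
    have h3 : 1 + C * v ^ 4 ≤ (1 + C * v) ^ 4 := by
      have h5 : C * v ^ 4 ≤ C ^ 4 * v ^ 4 := by
        gcongr
        exact le_self_pow₀ hC1 (by norm_num)
      have : 0 ≤ C * v := by positivity
      have e : (1 + C * v) ^ 4 = 1 + C ^ 4 * v ^ 4 + 4 * (C * v) + 6 * (C * v) ^ 2 + 4 * (C * v) ^ 3 := by ring
      rw [e]
      have : 0 ≤ (C * v) ^ 2 := by positivity
      have : 0 ≤ (C * v) ^ 3 := by positivity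
      linarith
    have h6 : ‖z - a0‖ + C = ‖z - a0‖ * (1 + C * v ^ 4) := by
      rw [hv4]; field_simp
    have h7 := mul_le_mul_of_nonneg_left h3 hp.le
    linarith
  have hw : 0 < 1 + C * v := by positivity
  calc Real.log (2 + 2 * ‖z‖) ≤ Real.log (2 * (‖z - a0‖ * (1 + C * v) ^ 4)) :=
        Real.log_le_log (by positivity) h1
    _ = Real.log 2 + Real.log ‖z - a0‖ + 4 * Real.log (1 + C * v) := by
        rw [Real.log_mul (by norm_num) (by positivity), Real.log_mul hp.ne' (by positivity),
          Real.log_pow]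
        push_cast; ring
    _ ≤ _ := by
        have h8 := Real.log_le_sub_one_of_pos hw
        have h9 : C * v ≤ C * u := by gcongr
        linarith


lemma omega_open {a b : ℕ → ℝ}
    (hdist : Tendsto (fun m => Metric.infDist (0 : ℝ) (Icc (a m) (b m))) atTop atTop) :
    IsOpen (cplx (⋃ m, Icc (a m) (b m)))ᶜ := by
  rw [isOpen_compl_iff]
  refine Complex.isometry_ofReal.isClosedEmbedding.isClosedMap _ ?_
  refine LocallyFinite.isClosed_iUnion ?_ (fun _ => isClosed_Icc)
  intro x
  refine ⟨Metric.ball x 1, Metric.ball_mem_nhds x one_pos, ?_⟩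
  have h := hdist.eventually (eventually_gt_atTop (|x| + 1))
  obtain ⟨N, hN⟩ := eventually_atTop.mp h
  refine (Set.finite_Iio N).subset ?_
  rintro m ⟨y, hy1, hy2⟩
  by_contra hm
  have h1 := hN m (by simpa using hm)
  have h2 := Metric.infDist_le_dist_of_mem (x := (0:ℝ)) hy1
  rw [Real.dist_eq, zero_sub, abs_neg] at h2
  rw [Metric.mem_ball, Real.dist_eq] at hy2
  have := abs_add_le (y - x) x
  rw [sub_add_cancel] at this
  linarith

lemma phi_diff {U : Set ℂ} (hU : IsOpen U) {lam e β : ℕ → ℝ} (hlam : ∀ n, (lam n : ℂ) ∉ U)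
    (he : ∀ n, 0 ≤ e n) (h1 : Summable e)
    (h2 : Summable (fun n => e n * β n ^ (1/4:ℝ))) (q : ℕ → ℂ → ℂ)
    (hq : ∀ n, ∀ z ∈ U, DifferentiableAt ℂ (q n) z ∧
      (‖z - lam n‖⁻¹) ^ (1/4:ℝ) ≤ (q n z).re ∧
      ‖q n z‖ ≤ 3 * β n ^ (1/4:ℝ) + 2 * (‖z - lam n‖⁻¹) ^ (1/4:ℝ)) :
    DifferentiableOn ℂ (fun z => ∑' n, (e n : ℂ) * q n z) U ∧
    ∀ z ∈ U, Summable (fun n => e n * (‖z - lam n‖⁻¹) ^ (1/4:ℝ)) ∧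
      ∑' n, e n * (‖z - lam n‖⁻¹) ^ (1/4:ℝ) ≤ (∑' n, (e n : ℂ) * q n z).re := by
  have key : ∀ z0 ∈ U, ∃ δ > 0, Metric.ball z0 δ ⊆ U ∧ ∀ n, ∀ z ∈ Metric.ball z0 δ,
      (‖z - lam n‖⁻¹) ^ (1/4:ℝ) ≤ (δ⁻¹) ^ (1/4:ℝ) := by
    intro z0 hz0
    obtain ⟨ε, hε, hb⟩ := Metric.isOpen_iff.mp hU z0 hz0
    refine ⟨ε / 2, by positivity, (Metric.ball_subset_ball (by linarith)).trans hb, ?_⟩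
    intro n z hz
    have : ε / 2 ≤ ‖z - lam n‖ := by
      by_contra hlt
      push Not at hlt
      apply hlam n
      apply hb
      rw [Metric.mem_ball] at hz ⊢
      have := dist_triangle (lam n : ℂ) z z0
      rw [dist_comm (lam n : ℂ) z, dist_eq_norm z] at this
      linarith
    apply Real.rpow_le_rpow (by positivity) _ (by norm_num)
    exact inv_anti₀ (by positivity) this
  have hsm : ∀ d : ℝ, Summable (fun n => e n * (3 * β n ^ (1/4:ℝ) + 2 * d)) := by
    intro d
    have := (h2.mul_left 3).add (h1.mul_right (2 * d))
    refine this.congr fun n => ?_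
    ring
  have hbd : ∀ n, ∀ z ∈ U, ∀ d : ℝ, (‖z - lam n‖⁻¹) ^ (1/4:ℝ) ≤ d →
      ‖(e n : ℂ) * q n z‖ ≤ e n * (3 * β n ^ (1/4:ℝ) + 2 * d) := by
    intro n z hz d hd
    rw [norm_mul, norm_real, Real.norm_of_nonneg (he n)]
    have := (hq n z hz).2.2
    apply mul_le_mul_of_nonneg_left _ (he n)
    linarith
  constructor
  · intro z0 hz0
    obtain ⟨δ, hδ, hbU, hin⟩ := key z0 hz0
    have hd := Complex.differentiableOn_tsum_of_summable_norm (F := fun n z => (e n : ℂ) * q n z)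
      (U := Metric.ball z0 δ) (hsm ((δ⁻¹) ^ (1/4:ℝ)))
      (fun n z hz => (((hq n z (hbU hz)).1).const_mul _).differentiableWithinAt)
      Metric.isOpen_ball (fun n z hz => hbd n z (hbU hz) _ (hin n z hz))
    exact (hd.differentiableAt (Metric.ball_mem_nhds z0 hδ)).differentiableWithinAt
  · intro z hz
    obtain ⟨δ, hδ, hbU, hin⟩ := key z hz
    have hzz : z ∈ Metric.ball z δ := Metric.mem_ball_self hδ
    have hsC : Summable (fun n => (e n : ℂ) * q n z) :=
      Summable.of_norm_bounded (hsm ((δ⁻¹) ^ (1/4:ℝ))) (fun n => hbd n z hz _ (hin n z hzz))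
    have hs : Summable (fun n => e n * (‖z - lam n‖⁻¹) ^ (1/4:ℝ)) :=
      Summable.of_nonneg_of_le (fun n => by have := he n; positivity)
        (fun n => mul_le_mul_of_nonneg_left (hin n z hzz) (he n)) (h1.mul_right _)
    refine ⟨hs, ?_⟩
    rw [Complex.re_tsum hsC]
    refine hs.tsum_le_tsum (fun n => ?_) (Complex.reCLM.summable hsC)
    rw [Complex.re_ofReal_mul]
    exact mul_le_mul_of_nonneg_left (hq n z hz).2.1 (he n)

theorem stmt6 (a b : ℕ → ℝ) (hab : ∀ m, a m < b m)
    (hdisj : ∀ m n, m ≠ n → Disjoint (Icc (a m) (b m)) (Icc (a n) (b n)))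
    (hdist : Tendsto (fun m => Metric.infDist (0 : ℝ) (Icc (a m) (b m))) atTop atTop)
    (E : Set ℝ) (hE : E = ⋃ m, Icc (a m) (b m))
    (f : ℂ → ℂ) (lam : ℕ → ℝ) (hf : KreinClass f lam)
    (hzeros : ∀ n, lam n ∈ E)
    (c M : ℝ) (hc : 0 < c)
    (hlen : ∀ n m, lam n ∈ Icc (a m) (b m) →
      c / ((1 + |lam n| ^ M) * ‖deriv f (lam n)‖) ≤ b m - a m) :
    BoundedTypeOn f (cplx E)ᶜ := by
  have hl := krein_summ hf
  obtain ⟨hd, hinj, hz, hd0, hs, hrep⟩ := hf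
  have hU : IsOpen (cplx E)ᶜ := by rw [hE]; exact omega_open hdist
  set U := (cplx E)ᶜ with hUd
  have hsub : ∀ m, ∀ z ∈ U, z ∉ cplx (Icc (a m) (b m)) := by
    rintro m z hzU ⟨x, hx, rfl⟩
    apply hzU
    refine ⟨x, ?_, rfl⟩
    rw [hE]
    exact mem_iUnion.mpr ⟨m, hx⟩
  have hlU : ∀ n, (lam n : ℂ) ∉ U := fun n h => h ⟨lam n, hzeros n, rfl⟩
  have hex : ∀ n, ∃ m, lam n ∈ Icc (a m) (b m) := by
    intro n
    have := hzeros n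
    rw [hE] at this
    exact mem_iUnion.mp this
  choose mm hmm using hex
  choose q hq using fun n => exists_q (a (mm n)) (b (mm n)) (lam n) (hab _) (hmm n)
  obtain ⟨qa, hqa⟩ := exists_q (a 0) (b 0) (a 0) (hab 0) ⟨le_refl _, (hab 0).le⟩
  set cc : ℕ → ℝ := fun n => 1 / ‖deriv f (lam n)‖ with hccd
  set β : ℕ → ℝ := fun n => 2 / (b (mm n) - a (mm n)) with hβd
  have hcc : ∀ n, 0 ≤ cc n := fun n => by simp only [hccd]; positivity
  have hβ : ∀ n, 0 ≤ β n := fun n => by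
    have := hab (mm n)
    exact div_nonneg (by norm_num) (by linarith)
  have hcb : ∀ n, cc n * β n ≤ (2 / c) * (1 + |lam n| ^ M) := by
    intro n
    have h1 := hlen n (mm n) (hmm n)
    have hdp : 0 < ‖deriv f (lam n)‖ := norm_pos_iff.mpr (hd0 n)
    have hL : 0 < b (mm n) - a (mm n) := by linarith [hab (mm n)]
    have hP : 0 < 1 + |lam n| ^ M := by positivity
    rw [div_le_iff₀ (by positivity)] at h1
    simp only [hccd, hβd]
    rw [div_mul_div_comm, div_mul_eq_mul_div, div_le_div_iff₀ (by positivity) hc]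
    nlinarith
  obtain ⟨K, hs1, hs2⟩ := weights hcc hβ hs hl (by positivity) hcb
  set e : ℕ → ℝ := fun n => cc n ^ (1/4:ℝ) * ((1 + |lam n|) ^ K)⁻¹ with hed
  have he : ∀ n, 0 ≤ e n := fun n => by have := hcc n; simp only [hed]; positivity
  obtain ⟨hΦd, hΦ⟩ := phi_diff hU hlU he hs1 hs2 q (fun n z hzU => hq n z (hsub _ z hzU))
  set Φ : ℂ → ℂ := fun z => ∑' n, (e n : ℂ) * q n z with hΦdef
  set A := ∑' n, cc n with hA
  have hA0 : 0 ≤ A := tsum_nonneg hcc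
  set C0 := 1 + |a 0| with hC0
  set Ψ : ℂ → ℂ := fun z => 4 * Φ z + ((4 * K * (4 * C0) : ℝ) : ℂ) * qa z with hΨ
  set k : ℝ := 4 * K with hk
  set cst : ℝ := 1 + Real.log (1 + A) + k * Real.log 2 with hcst
  have hfU : ∀ z ∈ U, f z ≠ 0 := by
    intro z hzU h
    obtain ⟨n, rfl⟩ := (hz z).mp h
    exact hlU n hzU
  have haU : ∀ z ∈ U, z ≠ (a 0 : ℂ) := by
    rintro z hzU rfl
    exact hsub 0 _ hzU ⟨a 0, ⟨le_refl _, (hab 0).le⟩, rfl⟩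
  have hmain : ∀ z ∈ U, Real.log ‖f z‖⁻¹ ≤ k * Real.log ‖z - a 0‖ + (Ψ z).re + cst - 1 ∧
      0 ≤ k * Real.log ‖z - a 0‖ + (Ψ z).re + cst - 1 := by
    intro z hzU
    obtain ⟨hts, hTΦ⟩ := hΦ z hzU
    obtain ⟨hr1, hr2⟩ := hrep z (hfU z hzU)
    have hterm : ∀ n, ‖1 / (deriv f (lam n) * (z - (lam n : ℂ)))‖ = cc n * ‖z - lam n‖⁻¹ := by
      intro n
      simp only [hccd]
      rw [norm_div, norm_one, norm_mul, one_div, mul_inv, one_div]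
    simp only [hterm] at hr1
    have hb1 : ‖f z‖⁻¹ ≤ ∑' n, cc n * ‖z - lam n‖⁻¹ := by
      rw [← norm_inv, ← one_div, hr2]
      refine (norm_tsum_le_tsum_norm (by simpa only [hterm] using hr1)).trans (le_of_eq ?_)
      simp only [hterm]
    have hb2 := sum_bd hcc hs z K hts hr1
    set T := ∑' n, cc n ^ (1/4:ℝ) * ((1 + |lam n|) ^ K)⁻¹ * (‖z - lam n‖⁻¹) ^ (1/4:ℝ) with hT
    have hT0 : 0 ≤ T := tsum_nonneg fun n => by have := hcc n; positivity
    have hTΦ' : T ≤ (Φ z).re := hTΦ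
    set W := 2 + 2 * ‖z‖ with hW
    have hW1 : 1 ≤ W := by linarith [norm_nonneg z]
    have hWk : 1 ≤ W ^ (4 * K) := one_le_pow₀ hW1
    have hT4 : 1 + T ^ 4 ≤ (1 + T) ^ 4 := by
      have e4 : (1 + T) ^ 4 = 1 + T ^ 4 + (4 * T + 6 * T ^ 2 + 4 * T ^ 3) := by ring
      rw [e4]
      have : 0 ≤ 4 * T + 6 * T ^ 2 + 4 * T ^ 3 := by positivity
      linarith
    have hG : A + W ^ (4 * K) * T ^ 4 ≤ (1 + A) * (W ^ (4 * K) * (1 + T) ^ 4) := by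
      have g1 : A ≤ A * W ^ (4 * K) := le_mul_of_one_le_right hA0 hWk
      have g2 : (1 + A) * (W ^ (4 * K) * (1 + T ^ 4)) ≤ (1 + A) * (W ^ (4 * K) * (1 + T) ^ 4) := by
        gcongr
      have g3 : 0 ≤ W ^ (4 * K) := by positivity
      have g4 : 0 ≤ A * W ^ (4 * K) * T ^ 4 := by positivity
      nlinarith
    have hG1 : 1 ≤ (1 + A) * (W ^ (4 * K) * (1 + T) ^ 4) := by
      have g1 : 1 ≤ (1 + T) ^ 4 := one_le_pow₀ (by linarith)
      exact one_le_mul_of_one_le_of_one_le (by linarith) (one_le_mul_of_one_le_of_one_le hWk g1)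
    have hlog : Real.log ((1 + A) * (W ^ (4 * K) * (1 + T) ^ 4)) ≤
        k * Real.log ‖z - a 0‖ + (Ψ z).re + cst - 1 := by
      rw [Real.log_mul (by positivity) (by positivity), Real.log_mul (by positivity) (by positivity),
        Real.log_pow, Real.log_pow]
      have g1 := log_bd z (a 0) (haU z hzU) (hqa z (hsub 0 z hzU)).2.1
      have g2 : Real.log (1 + T) ≤ (Φ z).re := by
        have := Real.log_le_sub_one_of_pos (show 0 < 1 + T by linarith)
        linarith
      have g3 : (Ψ z).re = 4 * (Φ z).re + k * (4 * C0) * (qa z).re := by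
        simp only [hΨ]
        rw [Complex.add_re, Complex.re_ofReal_mul]
        congr 1
        have : (4 : ℂ) = ((4 : ℝ) : ℂ) := by norm_num
        rw [this, Complex.re_ofReal_mul]
      have hk0 : 0 ≤ k := by positivity
      have g4 := mul_le_mul_of_nonneg_left g1 hk0
      rw [g3, hcst]
      push_cast
      rw [← hk]
      linarith
    constructor
    · refine le_trans (Real.log_le_log ?_ (hb1.trans (hb2.trans hG))) hlog
      have := norm_pos_iff.mpr (hfU z hzU)
      positivity
    · exact (Real.log_nonneg hG1).trans hlog
  refine ⟨fun z => Real.log ‖f z‖ + (k * Real.log ‖z - a 0‖ + ((Ψ z).re + cst)), ?_, ?_, ?_⟩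
  · apply harmOn_of hU
    intro z hzU
    have hUn : U ∈ nhds z := hU.mem_nhds hzU
    have hqad : DifferentiableOn ℂ qa U := fun w hw =>
      (hqa w (hsub 0 w hw)).1.differentiableWithinAt
    have hΨa : AnalyticAt ℂ Ψ z :=
      ((hΦd.const_mul 4).add (hqad.const_mul _)).analyticAt hUn
    have i1 := AnalyticAt.harmonicAt_log_norm (hd.analyticAt z) (hfU z hzU)
    have i2 := AnalyticAt.harmonicAt_log_norm (f := fun w => w - (a 0 : ℂ)) (z := z) (by fun_prop)
      (sub_ne_zero.mpr (haU z hzU))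
    have i3 := hΨa.harmonicAt_re
    exact i1.add ((i2.const_smul (c := k)).add (i3.add (InnerProductSpace.harmonicAt_const cst)))
  · intro z hzU
    have := (hmain z hzU).1
    rw [Real.log_inv] at this
    linarith
  · intro z hzU
    have h1 := (hmain z hzU).1
    have h2 := (hmain z hzU).2
    rw [Real.log_inv] at h1
    apply max_le <;> linarith
end

section
/- Let E = ⋃_m I_m, where I_m = [a_m, b_m] (a_m < b_m) are pairwise disjoint closed intervals in ℝ with dist(0, I_m) → ∞ as m → ∞, and suppose there are constants c > 0 and M < ∞ such that |I_m| ≥ c(1 + dist(0, I_m))^{-M} for every m. Let (λ_n) be a sequence of points of E and let c_n ≥ 0 satisfy ∑_n c_n (1 + |λ_n|^M) < ∞. Then the series g(z) = ∑_n c_n/(z − λ_n) converges absolutely for every z ∈ ℂ∖E, defines an analytic function on ℂ∖E, and g is of bounded type in ℂ∖E: there exists a positive harmonic function h on ℂ∖E with log⁺|g(z)| ≤ h(z) for all z ∈ ℂ∖E. -/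
open Complex Filter Set

lemma harmonicOn_of_nhd {h : ℂ → ℝ} {U : Set ℂ} (hU : IsOpen U)
    (hh : InnerProductSpace.HarmonicOnNhd h U) : HarmonicOn h U := by
  refine ⟨hh.contDiffOn, fun z hz => ?_⟩
  rw [iteratedFDerivWithin_of_isOpen 2 hU hz]
  have h2 := (hh z hz).2.self_of_nhds
  rw [InnerProductSpace.laplacian_eq_iteratedFDeriv_complexPlane] at h2
  simpa using h2

lemma root4 {w : ℂ} (hw : w ∈ slitPlane) :
    (exp (log w / 4)) ^ 4 = w ∧ 0 < (exp (log w / 4)).re ∧ 0 < ((exp (log w / 4)) ^ 2).re := by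
  have h0 : w ≠ 0 := slitPlane_ne_zero hw
  have h1 := Complex.neg_pi_lt_arg w
  have h2 := Complex.arg_le_pi w
  have h3 : w.arg ≠ Real.pi := slitPlane_arg_ne_pi hw
  have h4 : w.arg < Real.pi := lt_of_le_of_ne h2 h3
  have hpi := Real.pi_pos
  have e4 : (log w / 4).im = w.arg / 4 := by
    have := Complex.div_ofNat_im (log w) 4
    rw [this, Complex.log_im]
  have e2 : (log w / 2).im = w.arg / 2 := by
    have := Complex.div_ofNat_im (log w) 2
    rw [this, Complex.log_im]
  refine ⟨?_, ?_, ?_⟩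
  · rw [← Complex.exp_nat_mul]
    rw [show ((4 : ℕ) : ℂ) * (log w / 4) = log w by push_cast; ring, Complex.exp_log h0]
  · rw [Complex.exp_re, e4]
    exact mul_pos (Real.exp_pos _) (Real.cos_pos_of_mem_Ioo ⟨by linarith, by linarith⟩)
  · rw [← Complex.exp_nat_mul]
    rw [show ((2 : ℕ) : ℂ) * (log w / 4) = log w / 2 by push_cast; ring]
    rw [Complex.exp_re, e2]
    exact mul_pos (Real.exp_pos _) (Real.cos_pos_of_mem_Ioo ⟨by linarith, by linarith⟩)

lemma root2 {w : ℂ} (hw : 0 < w.re) :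
    (exp (log w / 2)) ^ 2 = w ∧ 0 < (exp (log w / 2)).re := by
  have hs : w ∈ slitPlane := Or.inl hw
  have h := root4 hs
  have e : exp (log w / 2) = (exp (log w / 4)) ^ 2 := by
    rw [← Complex.exp_nat_mul]
    congr 1; push_cast; ring
  rw [e]
  refine ⟨?_, h.2.2⟩
  rw [← pow_mul]; exact h.1

lemma norm_sq_le {r : ℂ} (h : 0 ≤ (r ^ 2).re) : ‖r‖ ^ 2 ≤ 2 * r.re ^ 2 := by
  rw [Complex.sq_norm, Complex.normSq_apply]
  rw [sq, Complex.mul_re] at h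
  nlinarith

lemma inv_re_nonneg {s : ℂ} (h : 0 ≤ s.re) : 0 ≤ (s⁻¹).re := by
  rw [Complex.inv_re]; exact div_nonneg h (Complex.normSq_nonneg _)

lemma inv_re_pos {s : ℂ} (h : 0 < s.re) : 0 < (s⁻¹).re := by
  rw [Complex.inv_re]; refine div_pos h (Complex.normSq_pos.2 ?_)
  rintro rfl; simp at h

lemma ratio_slit {a b : ℝ} (hab : a < b) {z : ℂ} (hz : ∀ x ∈ Icc a b, z ≠ (x : ℂ)) :
    (z - a) / (z - b) ∈ slitPlane := by
  by_contra hcon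
  rw [Complex.mem_slitPlane_iff] at hcon
  push Not at hcon
  obtain ⟨h1, h2⟩ := hcon
  set t : ℝ := -((z - a) / (z - b)).re with ht
  have hb : z - b ≠ 0 := sub_ne_zero.2 (hz b ⟨hab.le, le_rfl⟩)
  have ht0 : 0 ≤ t := by linarith
  have e : (z - a) / (z - b) = ((-t : ℝ) : ℂ) := by
    apply Complex.ext
    · simp [ht]
    · simpa using h2
  rw [div_eq_iff hb] at e
  have ht1 : (1 + t : ℝ) ≠ 0 := by positivity
  have ht1' : (1 + t : ℂ) ≠ 0 := by exact_mod_cast ht1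
  refine hz ((a + t * b) / (1 + t)) ⟨?_, ?_⟩ ?_
  · rw [le_div_iff₀ (by positivity)]; nlinarith
  · rw [div_le_iff₀ (by positivity)]; nlinarith
  · push_cast at e ⊢
    rw [eq_div_iff ht1']
    linear_combination e

lemma term_re {a b x c : ℝ} (hab : a < b) (hx : x ∈ Icc a b) (hc : 0 ≤ c) {z S : ℂ}
    (hS : 0 < S.re) (hzb : z - b ≠ 0) (hzS : (z - b) * S ^ 2 = z - a) (hzx : z - x ≠ 0) :
    0 ≤ ((z - b) * S * ((c : ℂ) / (z - x))).re := by
  have hL : 0 < b - a := by linarith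
  have hLc : (b - a : ℂ) ≠ 0 := by exact_mod_cast hL.ne'
  have hS0 : S ≠ 0 := by rintro rfl; simp at hS
  set t : ℝ := (b - x) / (b - a) with ht
  have ht0 : 0 ≤ t := div_nonneg (by linarith [hx.2]) hL.le
  have ht1 : 0 ≤ 1 - t := by
    rw [ht, sub_nonneg, div_le_one hL]; linarith [hx.1]
  have htc : (t : ℂ) * (b - a) = b - x := by
    rw [ht]; push_cast; field_simp
  have e1 : z - x = (z - b) * S * (t * S + ((1 - t : ℝ) : ℂ) * S⁻¹) := by
    have : (z - b) * S * (t * S + ((1 - t : ℝ) : ℂ) * S⁻¹)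
        = t * ((z - b) * S ^ 2) + (1 - t) * (z - b) := by
      push_cast; field_simp
    rw [this, hzS]
    linear_combination -htc
  have e2 : (z - b) * S * ((c : ℂ) / (z - x)) = (c : ℂ) * (t * S + ((1 - t : ℝ) : ℂ) * S⁻¹)⁻¹ := by
    have hne : (t * S + ((1 - t : ℝ) : ℂ) * S⁻¹) ≠ 0 := by
      intro h0; rw [h0, mul_zero] at e1; exact hzx e1
    rw [e1]; field_simp
  rw [e2, Complex.re_ofReal_mul]
  refine mul_nonneg hc (inv_re_nonneg ?_)
  rw [Complex.add_re, Complex.re_ofReal_mul, Complex.re_ofReal_mul]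
  have := (inv_re_pos hS).le
  positivity

lemma piece_bound {a b : ℝ} (hab : a < b) {z r G : ℂ} (hr : 0 < r.re) (hr2 : 0 < (r ^ 2).re)
    (hzr : (z - b) * r ^ 4 = z - a) (hF : 0 ≤ ((z - b) * r ^ 2 * G).re) :
    ‖G‖ ≤ 4 / (b - a) * (r.re + (r⁻¹).re + (exp (log (1 + (z - b) * r ^ 2 * G) / 2)).re) ^ 4 := by
  have hL : 0 < b - a := by linarith
  have hr0 : r ≠ 0 := by rintro rfl; simp at hr
  set F := (z - b) * r ^ 2 * G with hFdef
  have h1F : 0 < (1 + F).re := by simp; linarith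
  obtain ⟨hT, hTre⟩ := root2 h1F
  set T := exp (log (1 + F) / 2)
  have hri := inv_re_pos hr
  have hri2 : 0 ≤ ((r⁻¹) ^ 2).re := by
    rw [inv_pow]; exact (inv_re_pos hr2).le
  have b1 := norm_sq_le hr2.le
  have b2 := norm_sq_le hri2
  have b3 : ‖T‖ ^ 2 ≤ 2 * T.re ^ 2 := norm_sq_le (by rw [hT]; exact h1F.le)
  have b4 : ‖F‖ ≤ ‖T‖ ^ 2 := by
    rw [← norm_pow, hT]
    rw [← sq_le_sq₀ (norm_nonneg _) (norm_nonneg _), Complex.sq_norm, Complex.sq_norm,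
      Complex.normSq_apply, Complex.normSq_apply]
    simp only [Complex.add_re, Complex.one_re, Complex.add_im, Complex.one_im]
    nlinarith
  have e : ((b - a : ℝ) : ℂ) * G = F * (r ^ 2 - (r⁻¹) ^ 2) := by
    have : F * (r ^ 2 - (r⁻¹) ^ 2) = ((z - b) * r ^ 4 - (z - b)) * G := by
      rw [hFdef]; field_simp
    rw [this, hzr]; push_cast; ring
  have n : (b - a) * ‖G‖ ≤ ‖F‖ * (‖r‖ ^ 2 + ‖r⁻¹‖ ^ 2) := by
    have h := congrArg norm e
    rw [norm_mul, norm_mul, Complex.norm_real, Real.norm_of_nonneg hL.le] at h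
    rw [h, ← norm_pow, ← norm_pow]
    gcongr
    exact norm_sub_le _ _
  set p := r.re
  set q := (r⁻¹).re
  set s := T.re
  have n2 : (b - a) * ‖G‖ ≤ (2 * s ^ 2) * (2 * p ^ 2 + 2 * q ^ 2) := by
    refine n.trans ?_
    gcongr
    exact b4.trans b3
  have n3 : (2 * s ^ 2) * (2 * p ^ 2 + 2 * q ^ 2) ≤ 4 * (p + q + s) ^ 4 := by
    have i1 : s ^ 2 ≤ (p + q + s) ^ 2 := by gcongr; linarith
    have i2 : p ^ 2 + q ^ 2 ≤ (p + q + s) ^ 2 := by nlinarith [mul_pos hr hri, mul_pos hr hTre, mul_pos hri hTre]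
    calc (2 * s ^ 2) * (2 * p ^ 2 + 2 * q ^ 2) = 4 * (s ^ 2 * (p ^ 2 + q ^ 2)) := by ring
      _ ≤ 4 * ((p + q + s) ^ 2 * (p + q + s) ^ 2) := by gcongr
      _ = _ := by ring
  rw [div_mul_eq_mul_div, le_div_iff₀ hL]
  linarith

lemma piece_upper {a b δ R C : ℝ} (hab : a < b) (hL : b - a ≤ 1) (hδ : 0 < δ) (hC : 0 ≤ C)
    {z r G : ℂ} (hR : ‖z‖ ≤ R)
    (hza : δ ≤ ‖z - a‖) (hzb : δ ≤ ‖z - b‖) (hr : 0 < r.re)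
    (hzr : (z - b) * r ^ 4 = z - a) (hF : 0 ≤ ((z - b) * r ^ 2 * G).re) (hG : ‖G‖ ≤ C / δ) :
    ‖r + r⁻¹ + exp (log (1 + (z - b) * r ^ 2 * G) / 2)‖ ≤
      (6 + 2 / δ + (2 * R + 2) * (C / δ)) * (1 + |a|) := by
  have hr0 : r ≠ 0 := by rintro rfl; simp at hr
  set F := (z - b) * r ^ 2 * G with hFdef
  have h1F : 0 < (1 + F).re := by simp; linarith
  obtain ⟨hT, hTre⟩ := root2 h1F
  set T := exp (log (1 + F) / 2)
  have key : ∀ x : ℝ, 0 ≤ x → x ≤ 1 + x ^ 4 := fun x hx => by nlinarith [sq_nonneg (x^2 - 1/2), sq_nonneg (x - 1/2)]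
  have key2 : ∀ x : ℝ, x ≤ 1 + x ^ 2 := fun x => by nlinarith [sq_nonneg (x - 1/2)]
  have pa : 0 < ‖z - a‖ := hδ.trans_le hza
  have pb : 0 < ‖z - b‖ := hδ.trans_le hzb
  have hba : ‖((b - a : ℝ) : ℂ)‖ ≤ 1 := by
    rw [Complex.norm_real, Real.norm_of_nonneg (by linarith)]; exact hL
  have tab : ‖z - a‖ ≤ ‖z - b‖ + 1 := by
    calc ‖z - a‖ = ‖(z - b) + ((b - a : ℝ) : ℂ)‖ := by congr 1; push_cast; ring
      _ ≤ _ := (norm_add_le _ _).trans (by linarith)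
  have tba : ‖z - b‖ ≤ ‖z - a‖ + 1 := by
    calc ‖z - b‖ = ‖(z - a) - ((b - a : ℝ) : ℂ)‖ := by congr 1; push_cast; ring
      _ ≤ _ := (norm_sub_le _ _).trans (by linarith)
  have n4 : ‖z - b‖ * ‖r‖ ^ 4 = ‖z - a‖ := by
    rw [← norm_pow, ← norm_mul, hzr]
  have hr4 : ‖r‖ ^ 4 ≤ 1 + 1 / δ := by
    have : ‖r‖ ^ 4 = ‖z - a‖ / ‖z - b‖ := by rw [eq_div_iff pb.ne']; linarith
    rw [this, div_le_iff₀ pb, add_mul, div_mul_eq_mul_div]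
    have : 1 ≤ 1 * ‖z - b‖ / δ := by rw [le_div_iff₀ hδ]; linarith
    linarith
  have hri4 : ‖r⁻¹‖ ^ 4 ≤ 1 + 1 / δ := by
    have : ‖r⁻¹‖ ^ 4 = ‖z - b‖ / ‖z - a‖ := by
      rw [eq_div_iff pa.ne', ← n4, norm_inv]
      have := norm_ne_zero_iff.2 hr0
      field_simp
    rw [this, div_le_iff₀ pa, add_mul, div_mul_eq_mul_div]
    have : 1 ≤ 1 * ‖z - a‖ / δ := by rw [le_div_iff₀ hδ]; linarith
    linarith
  have u1 := key _ (norm_nonneg r)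
  have u2 := key _ (norm_nonneg r⁻¹)
  have u3 := key2 ‖T‖
  have u4 : ‖T‖ ^ 2 ≤ 1 + ‖F‖ := by
    rw [← norm_pow, hT]
    exact (norm_add_le _ _).trans (by simp)
  have hzaR : ‖z - a‖ ≤ R + |a| := by
    refine (norm_sub_le _ _).trans ?_
    rw [Complex.norm_real, Real.norm_eq_abs]; linarith
  have u5 : ‖F‖ ≤ (2 * R + 2 * |a| + 1) * (C / δ) := by
    rw [hFdef, norm_mul]
    refine mul_le_mul ?_ hG (norm_nonneg _) (by have := norm_nonneg z; have := abs_nonneg a; linarith)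
    rw [norm_mul, norm_pow]
    have : ‖r‖ ^ 2 ≤ 1 + ‖r‖ ^ 4 := by nlinarith [sq_nonneg (‖r‖^2 - 1/2)]
    calc ‖z - b‖ * ‖r‖ ^ 2 ≤ ‖z - b‖ * (1 + ‖r‖ ^ 4) := by gcongr
      _ = ‖z - b‖ + ‖z - a‖ := by rw [mul_add, n4, mul_one]
      _ ≤ _ := by linarith
  have hR0 : 0 ≤ R := (norm_nonneg z).trans hR
  have ha0 := abs_nonneg a
  have hCδ : 0 ≤ C / δ := by positivity
  have hδi : 0 < 1 / δ := by positivity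
  have tri : ‖r + r⁻¹ + T‖ ≤ ‖r‖ + ‖r⁻¹‖ + ‖T‖ :=
    norm_add₃_le
  have e2 : 2 / δ = 2 * (1 / δ) := by ring
  rw [e2]
  have : (2 * R + 2 * |a| + 1) * (C / δ) ≤ (2 * R + 2) * (C / δ) * (1 + |a|) := by
    have : 2 * R + 2 * |a| + 1 ≤ (2 * R + 2) * (1 + |a|) := by nlinarith [mul_nonneg hR0 ha0]
    calc _ ≤ ((2 * R + 2) * (1 + |a|)) * (C / δ) := by gcongr
      _ = _ := by ring
  nlinarith [mul_nonneg hδi.le ha0]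

lemma cauchy_summable {ν : Type*} {K : Set ℂ} {l : ν → ℂ} (hl : ∀ n, l n ∈ K)
    {c : ν → ℝ} (hc : ∀ n, 0 ≤ c n) (hs : Summable c) {z : ℂ} {δ : ℝ} (hδ : 0 < δ)
    (hz : ∀ x ∈ K, δ ≤ ‖z - x‖) :
    Summable (fun n => ‖(c n : ℂ) / (z - l n)‖) ∧ ‖∑' n, (c n : ℂ) / (z - l n)‖ ≤ (∑' n, c n) / δ := by
  have hle : ∀ n, ‖(c n : ℂ) / (z - l n)‖ ≤ c n / δ := fun n => by
    rw [norm_div, Complex.norm_real, Real.norm_of_nonneg (hc n)]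
    exact div_le_div_of_nonneg_left (hc n) hδ (hz _ (hl n))
  have h1 : Summable (fun n => ‖(c n : ℂ) / (z - l n)‖) :=
    Summable.of_nonneg_of_le (fun n => norm_nonneg _) hle (hs.div_const δ)
  refine ⟨h1, (norm_tsum_le_tsum_norm h1).trans ?_⟩
  rw [← tsum_div_const]
  exact h1.tsum_le_tsum hle (hs.div_const δ)

lemma exists_delta {K : Set ℂ} (hK : IsClosed K) {z : ℂ} (hz : z ∈ Kᶜ) :
    ∃ δ > 0, (∀ y ∈ Metric.ball z δ, ∀ x ∈ K, δ ≤ ‖y - x‖) := by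
  obtain ⟨ε, hε, h⟩ := Metric.isOpen_iff.1 hK.isOpen_compl z hz
  refine ⟨ε / 2, by positivity, fun y hy x hx => ?_⟩
  by_contra hcon
  push Not at hcon
  refine h (Metric.mem_ball.2 ?_) hx
  have h1 : dist x z ≤ dist x y + dist y z := dist_triangle _ _ _
  rw [dist_comm x y, dist_eq_norm y x] at h1
  have := Metric.mem_ball.1 hy
  linarith

lemma cauchy_diff {ν : Type*} {K : Set ℂ} (hK : IsClosed K) {l : ν → ℂ} (hl : ∀ n, l n ∈ K)
    {c : ν → ℝ} (hc : ∀ n, 0 ≤ c n) (hs : Summable c) :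
    DifferentiableOn ℂ (fun z => ∑' n, (c n : ℂ) / (z - l n)) Kᶜ := by
  intro z hz
  obtain ⟨δ, hδ, h⟩ := exists_delta hK hz
  refine DifferentiableAt.differentiableWithinAt ?_
  have : DifferentiableOn ℂ (fun z => ∑' n, (c n : ℂ) / (z - l n)) (Metric.ball z δ) := by
    refine differentiableOn_tsum_of_summable_norm (hs.div_const δ) (fun n y hy => ?_)
      Metric.isOpen_ball (fun n y hy => ?_)
    · have : y - l n ≠ 0 := norm_pos_iff.1 (hδ.trans_le (h y hy _ (hl n)))
      refine DifferentiableAt.differentiableWithinAt ?_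
      fun_prop (disch := assumption)
    · rw [norm_div, Complex.norm_real, Real.norm_of_nonneg (hc n)]
      exact div_le_div_of_nonneg_left (hc n) hδ (h y hy _ (hl n))
  exact this.differentiableAt (Metric.ball_mem_nhds z hδ)

noncomputable def rt (a b : ℝ) (z : ℂ) : ℂ := exp (log ((z - a) / (z - b)) / 4)

noncomputable def Hf (a b : ℝ) (G : ℂ → ℂ) (z : ℂ) : ℂ :=
  rt a b z + (rt a b z)⁻¹ + exp (log (1 + (z - b) * rt a b z ^ 2 * G z) / 2)

lemma rt_spec {a b : ℝ} (hab : a < b) {z : ℂ} (hz : ∀ x ∈ Icc a b, z ≠ (x : ℂ)) :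
    (z - b) * rt a b z ^ 4 = z - a ∧ 0 < (rt a b z).re ∧ 0 < (rt a b z ^ 2).re := by
  have hb : z - b ≠ 0 := sub_ne_zero.2 (hz b ⟨hab.le, le_rfl⟩)
  obtain ⟨h1, h2, h3⟩ := root4 (ratio_slit hab hz)
  refine ⟨?_, h2, h3⟩
  rw [rt, h1]; field_simp

lemma rt_diff {a b : ℝ} (hab : a < b) {z : ℂ} (hz : ∀ x ∈ Icc a b, z ≠ (x : ℂ)) :
    DifferentiableAt ℂ (rt a b) z := by
  have hb : z - b ≠ 0 := sub_ne_zero.2 (hz b ⟨hab.le, le_rfl⟩)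
  have h : DifferentiableAt ℂ (fun z : ℂ => (z - a) / (z - b)) z := by
    fun_prop (disch := assumption)
  exact ((h.clog (ratio_slit hab hz)).div_const 4).cexp

lemma green {a b : ℝ} (hab : a < b) {z S : ℂ} (hS : 0 < S.re) (hzS : (z - b) * S ^ 2 = z - a) :
    1 - S ≠ 0 ∧ 1 + S ≠ 0 ∧ 1 ≤ ‖(1 + S) / (1 - S)‖ ∧ ‖z - b‖ ≤ (b - a) * ‖(1 + S) / (1 - S)‖ := by
  have hL : 0 < b - a := by linarith
  have e : (z - b) * ((1 - S) * (1 + S)) = ((a - b : ℝ) : ℂ) := by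
    push_cast; linear_combination -hzS
  have hne : (z - b) * ((1 - S) * (1 + S)) ≠ 0 := by
    rw [e]; exact_mod_cast (by linarith : a - b ≠ 0)
  have h1 : 1 - S ≠ 0 := fun h => hne (by rw [h]; ring)
  have h2 : 1 + S ≠ 0 := fun h => hne (by rw [h]; ring)
  have p1 : 0 < ‖1 - S‖ := norm_pos_iff.2 h1
  have hle : ‖1 - S‖ ≤ ‖1 + S‖ := by
    rw [← sq_le_sq₀ (norm_nonneg _) (norm_nonneg _), Complex.sq_norm, Complex.sq_norm,
      Complex.normSq_apply, Complex.normSq_apply]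
    simp only [Complex.add_re, Complex.one_re, Complex.add_im, Complex.one_im, Complex.sub_re,
      Complex.sub_im]
    nlinarith
  have h1S : 1 ≤ ‖1 + S‖ := by
    have := Complex.re_le_norm (1 + S)
    simp only [Complex.add_re, Complex.one_re] at this
    linarith
  refine ⟨h1, h2, ?_, ?_⟩
  · rw [norm_div, le_div_iff₀ p1]; linarith
  · have n := congrArg norm e
    rw [norm_mul, norm_mul, Complex.norm_real, Real.norm_of_nonpos (by linarith)] at n
    rw [norm_div, mul_div_assoc', le_div_iff₀ p1]
    have : ‖z - b‖ * ‖1 - S‖ ≤ ‖z - b‖ * (‖1 - S‖ * ‖1 + S‖) := by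
      gcongr
      nlinarith
    nlinarith

theorem core_s7 {ι : Type*} {K : Set ℂ} (hK : IsClosed K) (a b : ι → ℝ)
    (hab : ∀ i, a i < b i) (hL1 : ∀ i, b i - a i ≤ 1)
    (hsub : ∀ i, ∀ x ∈ Icc (a i) (b i), (x : ℂ) ∈ K)
    (c0 : ℝ) (hc0 : 0 < c0) (N : ℕ) (hlen : ∀ i, c0 / (1 + |a i|) ^ N ≤ b i - a i)
    (hw : Summable (fun i => 1 / (1 + |a i|) ^ (N + 2)))
    (lam cf : ℕ → ℝ) (idx : ℕ → ι) (hidx : ∀ n, lam n ∈ Icc (a (idx n)) (b (idx n)))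
    (hcf : ∀ n, 0 ≤ cf n) (hs : Summable cf) :
    BoundedTypeOn (fun z => ∑' n, (cf n : ℂ) / (z - (lam n : ℂ))) Kᶜ := by
  classical
  have hlamK : ∀ n, (lam n : ℂ) ∈ K := fun n => hsub _ _ (hidx n)
  set i0 := idx 0
  -- basic objects
  let G : ι → ℂ → ℂ := fun i z => ∑' n : idx ⁻¹' {i}, (cf n : ℂ) / (z - (lam n : ℂ))
  let w : ι → ℝ := fun i => 1 / (1 + |a i|) ^ (N + 3)
  let H : ι → ℂ → ℂ := fun i => Hf (a i) (b i) (G i)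
  let HH : ℂ → ℂ := fun z => ∑' i, (w i : ℂ) * H i z
  set C := ∑' n, cf n with hC
  have hC0 : 0 ≤ C := tsum_nonneg hcf
  have hone : ∀ i, 1 ≤ 1 + |a i| := fun i => by linarith [abs_nonneg (a i)]
  have hpos : ∀ i, 0 < 1 + |a i| := fun i => by linarith [hone i]
  have hw0 : ∀ i, 0 < w i := fun i => by have := hpos i; positivity
  have hww : ∀ i, w i * (1 + |a i|) = 1 / (1 + |a i|) ^ (N + 2) := fun i => by
    have := hpos i
    simp only [w]; field_simp; ring
  have hws : Summable w := by
    refine Summable.of_nonneg_of_le (fun i => (hw0 i).le) (fun i => ?_) hw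
    rw [← hww]; have := hw0 i; nlinarith [hone i]
  have hne : ∀ z ∈ Kᶜ, ∀ i, ∀ x ∈ Icc (a i) (b i), z ≠ (x : ℂ) := by
    rintro z hz i x hx rfl; exact hz (hsub i x hx)
  have hsubs : ∀ i, Summable (fun n : idx ⁻¹' {i} => cf n) := fun i => hs.subtype _
  have hCi : HasSum (fun i => ∑' n : idx ⁻¹' {i}, cf n) C := hs.hasSum.tsum_fiberwise idx
  have hCi0 : ∀ i, 0 ≤ ∑' n : idx ⁻¹' {i}, cf n := fun i => tsum_nonneg fun n => hcf n
  have hCile : ∀ i, ∑' n : idx ⁻¹' {i}, cf n ≤ C := fun i => le_hasSum hCi i fun j _ => hCi0 j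
  -- bounds on G
  have hGb : ∀ i z δ, 0 < δ → (∀ x ∈ Icc (a i) (b i), δ ≤ ‖z - (x : ℂ)‖) →
      Summable (fun n : idx ⁻¹' {i} => ‖(cf n : ℂ) / (z - (lam n : ℂ))‖) ∧
      ‖G i z‖ ≤ (∑' n : idx ⁻¹' {i}, cf n) / δ := by
    intro i z δ hδ h
    refine cauchy_summable (K := (fun x : ℝ => (x : ℂ)) '' Icc (a i) (b i))
      (l := fun n : idx ⁻¹' {i} => (lam n : ℂ)) ?_ (fun n => hcf n) (hsubs i) hδ ?_
    · rintro ⟨n, hn⟩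
      have : idx n = i := hn
      exact ⟨lam n, this ▸ hidx n, rfl⟩
    · rintro _ ⟨x, hx, rfl⟩; exact h x hx
  have hFre : ∀ z ∈ Kᶜ, ∀ i, 0 ≤ ((z - b i) * rt (a i) (b i) z ^ 2 * G i z).re := by
    intro z hz i
    obtain ⟨δ, hδ, hd⟩ := exists_delta hK hz
    have hd' := hd z (Metric.mem_ball_self hδ)
    obtain ⟨h1, h2, h3⟩ := rt_spec (hab i) (hne z hz i)
    have hsm := (hGb i z δ hδ (fun x hx => hd' _ (hsub i x hx))).1.of_norm
    simp only [G]
    rw [← tsum_mul_left, Complex.re_tsum (hsm.mul_left _)]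
    refine tsum_nonneg ?_
    rintro ⟨n, hn⟩
    have hn' : idx n = i := hn
    refine term_re (hab i) (hn' ▸ hidx n) (hcf n) h3 (sub_ne_zero.2 (hne z hz i _ ⟨(hab i).le, le_rfl⟩))
      ?_ (sub_ne_zero.2 (hne z hz i _ (hn' ▸ hidx n)))
    rw [← h1]; ring
  have hGd : ∀ i, DifferentiableOn ℂ (G i) Kᶜ := fun i =>
    cauchy_diff hK (l := fun n : idx ⁻¹' {i} => (lam n : ℂ)) (fun n => hlamK n)
      (fun n => hcf n) (hsubs i)
  have hHd : ∀ i, ∀ z ∈ Kᶜ, DifferentiableAt ℂ (H i) z := by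
    intro i z hz
    have d1 := rt_diff (hab i) (hne z hz i)
    have d2 := (hGd i).differentiableAt (hK.isOpen_compl.mem_nhds hz)
    have hr0 : rt (a i) (b i) z ≠ 0 := Complex.exp_ne_zero _
    have d3 : DifferentiableAt ℂ (fun z : ℂ => 1 + (z - b i) * rt (a i) (b i) z ^ 2 * G i z) z := by
      fun_prop
    have d4 := d3.clog (Or.inl (by
      have := hFre z hz i
      simp only [Complex.add_re, Complex.one_re]; linarith))
    exact (d1.add (d1.inv hr0)).add ((d4.div_const 2).cexp)
  have hHpos : ∀ z ∈ Kᶜ, ∀ i, 0 < (H i z).re := by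
    intro z hz i
    obtain ⟨h1, h2, h3⟩ := rt_spec (hab i) (hne z hz i)
    have hF := hFre z hz i
    have hT := (root2 (w := 1 + (z - b i) * rt (a i) (b i) z ^ 2 * G i z) (by
      simp only [Complex.add_re, Complex.one_re]; linarith)).2
    have := inv_re_pos h2
    simp only [H, Hf, Complex.add_re]
    linarith
  -- local bounds
  have hloc : ∀ z ∈ Kᶜ, ∃ δ > 0, ∃ B : ℝ, ∀ y ∈ Metric.ball z δ, y ∈ Kᶜ ∧ ∀ i,
      ‖(w i : ℂ) * H i y‖ ≤ B * (1 / (1 + |a i|) ^ (N + 2)) := by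
    intro z hz
    obtain ⟨δ, hδ, hd⟩ := exists_delta hK hz
    refine ⟨δ, hδ, (6 + 2 / δ + (2 * (‖z‖ + δ) + 2) * (C / δ)), fun y hy => ?_⟩
    have hyK : y ∈ Kᶜ := fun h => by
      have := hd y hy y h
      simp at this; linarith
    refine ⟨hyK, fun i => ?_⟩
    obtain ⟨h1, h2, h3⟩ := rt_spec (hab i) (hne y hyK i)
    have hG := (hGb i y δ hδ (fun x hx => hd y hy _ (hsub i x hx))).2
    have hG' : ‖G i y‖ ≤ C / δ := hG.trans (by gcongr; exact hCile i)
    have hyR : ‖y‖ ≤ ‖z‖ + δ := by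
      have := Metric.mem_ball.1 hy
      rw [dist_eq_norm] at this
      calc ‖y‖ = ‖z + (y - z)‖ := by congr 1; ring
        _ ≤ _ := (norm_add_le _ _).trans (by linarith)
    have := piece_upper (hab i) (hL1 i) hδ hC0 hyR (hd y hy _ (hsub i _ ⟨le_rfl, (hab i).le⟩))
      (hd y hy _ (hsub i _ ⟨(hab i).le, le_rfl⟩)) h2 h1 (hFre y hyK i) hG'
    rw [norm_mul, Complex.norm_real, Real.norm_of_nonneg (hw0 i).le, ← hww]
    calc w i * ‖H i y‖ ≤ w i * ((6 + 2 / δ + (2 * (‖z‖ + δ) + 2) * (C / δ)) * (1 + |a i|)) :=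
          mul_le_mul_of_nonneg_left this (hw0 i).le
      _ = _ := by ring
  have hHHd : ∀ z ∈ Kᶜ, AnalyticAt ℂ HH z := by
    intro z hz
    obtain ⟨δ, hδ, B, hB⟩ := hloc z hz
    have : DifferentiableOn ℂ HH (Metric.ball z δ) :=
      differentiableOn_tsum_of_summable_norm (hw.mul_left B)
        (fun i y hy => (((hHd i y (hB y hy).1).const_mul _)).differentiableWithinAt)
        Metric.isOpen_ball (fun i y hy => (hB y hy).2 i)
    exact this.analyticAt (Metric.ball_mem_nhds z hδ)
  have hHHs : ∀ z ∈ Kᶜ, Summable (fun i => (w i : ℂ) * H i z) := by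
    intro z hz
    obtain ⟨δ, hδ, B, hB⟩ := hloc z hz
    exact Summable.of_norm_bounded (hw.mul_left B) (hB z (Metric.mem_ball_self hδ)).2
  have hU : ∀ z ∈ Kᶜ, ∀ i, w i * (H i z).re ≤ (HH z).re := by
    intro z hz i
    have h1 := Complex.hasSum_re (hHHs z hz).hasSum
    have := le_hasSum h1 i (fun j _ => by
      rw [Complex.re_ofReal_mul]; exact (mul_pos (hw0 j) (hHpos z hz j)).le)
    rwa [Complex.re_ofReal_mul] at this
  have hUpos : ∀ z ∈ Kᶜ, 0 < (HH z).re := fun z hz =>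
    (mul_pos (hw0 i0) (hHpos z hz i0)).trans_le (hU z hz i0)
  -- Green function
  let S : ℂ → ℂ := fun z => rt (a i0) (b i0) z ^ 2
  let Y : ℂ → ℂ := fun z => (1 + S z) / (1 - S z)
  have hgr : ∀ z ∈ Kᶜ, 1 - S z ≠ 0 ∧ 1 + S z ≠ 0 ∧ 1 ≤ ‖Y z‖ ∧
      ‖z - b i0‖ ≤ (b i0 - a i0) * ‖Y z‖ := by
    intro z hz
    obtain ⟨h1, h2, h3⟩ := rt_spec (hab i0) (hne z hz i0)
    exact green (hab i0) h3 (by rw [← h1]; simp only [S]; ring)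
  have hYa : ∀ z ∈ Kᶜ, AnalyticAt ℂ Y z := by
    intro z hz
    have hd : DifferentiableOn ℂ Y Kᶜ := by
      intro y hy
      have d1 := rt_diff (hab i0) (hne y hy i0)
      have d2 : DifferentiableAt ℂ S y := d1.pow 2
      exact ((d2.const_add 1).div (d2.const_sub 1) (hgr y hy).1).differentiableWithinAt
    exact hd.analyticAt (hK.isOpen_compl.mem_nhds hz)
  have hYlog : ∀ z ∈ Kᶜ, Real.log (3 + 2 * ‖z‖) ≤ Real.log (5 + 2 * |b i0|) + Real.log ‖Y z‖ := by
    intro z hz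
    obtain ⟨-, -, h1, h2⟩ := hgr z hz
    have hb := abs_nonneg (b i0)
    rw [← Real.log_mul (by positivity) (by positivity)]
    refine Real.log_le_log (by positivity) ?_
    have : ‖z‖ ≤ ‖z - b i0‖ + |b i0| := by
      calc ‖z‖ = ‖(z - b i0) + (b i0 : ℂ)‖ := by congr 1; ring
        _ ≤ _ := (norm_add_le _ _).trans (by rw [Complex.norm_real, Real.norm_eq_abs])
    have : (b i0 - a i0) * ‖Y z‖ ≤ 1 * ‖Y z‖ := by gcongr; exact hL1 i0
    nlinarith
  -- main estimate
  set W := ∑' i, w i with hW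
  have hW0 : 0 ≤ W := tsum_nonneg fun i => (hw0 i).le
  set Q := 5 * (N + 3) + N with hQ
  have hmain : ∀ z ∈ Kᶜ, ‖∑' n, (cf n : ℂ) / (z - (lam n : ℂ))‖ ≤
      C + W * ((4 / c0) * (HH z).re ^ 4 * (3 + 2 * ‖z‖) ^ Q) := by
    intro z hz
    set U := (HH z).re with hUdef
    have hU0 := hUpos z hz
    set X := (4 / c0) * U ^ 4 * (3 + 2 * ‖z‖) ^ Q with hX
    have hX0 : 0 ≤ X := by positivity
    obtain ⟨δ, hδ, hd⟩ := exists_delta hK hz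
    have hd' := hd z (Metric.mem_ball_self hδ)
    have hsm := (cauchy_summable (l := fun n => (lam n : ℂ)) hlamK hcf hs hδ hd').1.of_norm
    have hfib : HasSum (fun i => G i z) (∑' n, (cf n : ℂ) / (z - (lam n : ℂ))) :=
      hsm.hasSum.tsum_fiberwise idx
    rw [← hfib.tsum_eq]
    have hb : HasSum (fun i => (∑' n : idx ⁻¹' {i}, cf n) + w i * X) (C + W * X) :=
      hCi.add (hws.hasSum.mul_right X)
    refine tsum_of_norm_bounded hb fun i => ?_
    by_cases hnear : |a i| ≤ 2 * ‖z‖ + 2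
    · obtain ⟨h1, h2, h3⟩ := rt_spec (hab i) (hne z hz i)
      have hp := piece_bound (hab i) h2 h3 h1 (hFre z hz i)
      rw [← Complex.add_re, ← Complex.add_re] at hp
      change ‖G i z‖ ≤ 4 / (b i - a i) * (H i z).re ^ 4 at hp
      have hHU : (H i z).re ≤ U * (1 + |a i|) ^ (N + 3) := by
        have := hU z hz i
        simp only [w] at this
        rw [div_mul_eq_mul_div, div_le_iff₀ (by have := hpos i; positivity)] at this
        linarith
      have hLi : 4 / (b i - a i) ≤ 4 / c0 * (1 + |a i|) ^ N := by
        have hp := hpos i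
        have := hlen i
        rw [div_le_iff₀ (by positivity)] at this
        rw [div_le_iff₀ (by linarith [hab i]), div_mul_eq_mul_div, div_mul_eq_mul_div,
          le_div_iff₀ hc0]
        linarith
      have hHn := (hHpos z hz i).le
      have hpi := hpos i
      have : ‖G i z‖ ≤ w i * X := by
        calc ‖G i z‖ ≤ 4 / (b i - a i) * (H i z).re ^ 4 := hp
          _ ≤ (4 / c0 * (1 + |a i|) ^ N) * (U * (1 + |a i|) ^ (N + 3)) ^ 4 := by gcongr
          _ = w i * ((4 / c0) * U ^ 4 * (1 + |a i|) ^ Q) := by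
              simp only [w, hQ]
              rw [one_div_mul_eq_div, eq_div_iff (by positivity)]
              ring
          _ ≤ w i * X := by
              rw [hX]
              have := (hw0 i).le
              have h13 : (1 + |a i|) ^ Q ≤ (3 + 2 * ‖z‖) ^ Q :=
                pow_le_pow_left₀ hpi.le (by linarith) Q
              gcongr
      linarith [hCi0 i]
    · push Not at hnear
      have hfar := (hGb i z 1 one_pos (fun x hx => by
        have h1 : |x - a i| ≤ 1 := by
          rw [abs_of_nonneg (by linarith [hx.1])]; linarith [hx.2, hL1 i]
        have h2 : |a i| ≤ |x| + |x - a i| := by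
          calc |a i| = |x - (x - a i)| := by congr 1; ring
            _ ≤ _ := abs_sub _ _
        have h3 : |x| ≤ ‖z‖ + ‖z - (x : ℂ)‖ := by
          calc |x| = ‖(x : ℂ)‖ := by rw [Complex.norm_real, Real.norm_eq_abs]
            _ = ‖z - (z - (x : ℂ))‖ := by congr 1; ring
            _ ≤ _ := norm_sub_le _ _
        have := norm_nonneg z
        linarith)).2
      rw [div_one] at hfar
      have := mul_nonneg (hw0 i).le hX0
      linarith
  set A := 1 + C + W * (4 / c0) with hA
  have hWc : 0 ≤ W * (4 / c0) := by positivity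
  have hA1 : 1 ≤ A := by linarith
  set B := 5 + 2 * |b i0| with hB
  have hB1 : 1 ≤ B := by have := abs_nonneg (b i0); linarith
  refine ⟨fun z => Real.log A + 4 * (HH z).re + Q * (Real.log B + Real.log ‖Y z‖),
    harmonicOn_of_nhd hK.isOpen_compl ?_, ?_, ?_⟩
  · intro z hz
    have k1 := (hHHd z hz).harmonicAt_re
    have k2 := (hYa z hz).harmonicAt_log_norm (norm_pos_iff.1 (one_pos.trans_le (hgr z hz).2.2.1))
    have k3 := ((InnerProductSpace.harmonicAt_const (x := z) (Real.log A)).add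
      (k1.const_smul (c := (4 : ℝ)))).add
      (((InnerProductSpace.harmonicAt_const (x := z) (Real.log B)).add k2).const_smul (c := (Q : ℝ)))
    exact k3
  · intro z hz
    have := hUpos z hz
    have := Real.log_nonneg hA1
    have := Real.log_nonneg hB1
    have := Real.log_nonneg (hgr z hz).2.2.1
    positivity
  · intro z hz
    have u := hUpos z hz
    have lA := Real.log_nonneg hA1
    have lB := Real.log_nonneg hB1
    have lY := Real.log_nonneg (hgr z hz).2.2.1
    refine max_le ?_ (by positivity)
    set U := (HH z).re
    set g := ∑' n, (cf n : ℂ) / (z - (lam n : ℂ)) with hg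
    rcases eq_or_ne ‖g‖ 0 with h0 | h0
    · change Real.log ‖g‖ ≤ _
      rw [h0, Real.log_zero]; positivity
    have hz0 := norm_nonneg z
    have hle : ‖g‖ ≤ A * (1 + U) ^ 4 * (3 + 2 * ‖z‖) ^ Q := by
      refine (hmain z hz).trans ?_
      have i1 : 1 ≤ (3 + 2 * ‖z‖) ^ Q := one_le_pow₀ (by linarith)
      have i2 : 1 ≤ (1 + U) ^ 4 := one_le_pow₀ (by linarith)
      have i3 : 1 ≤ (1 + U) ^ 4 * (3 + 2 * ‖z‖) ^ Q := one_le_mul_of_one_le_of_one_le i2 i1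
      have i4 : U ^ 4 * (3 + 2 * ‖z‖) ^ Q ≤ (1 + U) ^ 4 * (3 + 2 * ‖z‖) ^ Q := by
        gcongr; linarith
      have i5 := mul_le_mul_of_nonneg_left i4 hWc
      have i6 := mul_le_mul_of_nonneg_left i3 hC0
      have e1 : W * ((4 / c0) * U ^ 4 * (3 + 2 * ‖z‖) ^ Q)
        = W * (4 / c0) * (U ^ 4 * (3 + 2 * ‖z‖) ^ Q) := by ring
      rw [e1, mul_assoc, hA]
      linarith
    have h1 := Real.log_le_log (lt_of_le_of_ne (norm_nonneg g) h0.symm) hle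
    rw [Real.log_mul (by positivity) (by positivity), Real.log_mul (by positivity) (by positivity),
      Real.log_pow, Real.log_pow] at h1
    have h2 : Real.log (1 + U) ≤ U := by
      have := Real.log_le_sub_one_of_pos (by linarith : 0 < 1 + U); linarith
    have h3 : (Q : ℝ) * Real.log (3 + 2 * ‖z‖) ≤ Q * (Real.log B + Real.log ‖Y z‖) :=
      mul_le_mul_of_nonneg_left (hYlog z hz) (by positivity)
    change Real.log ‖g‖ ≤ _
    push_cast at h1 h3 ⊢
    linarith

lemma sum_pieces {ι : Type*} [Countable ι] (a b : ι → ℝ)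
    (hab : ∀ i, a i < b i) (hL1 : ∀ i, b i - a i ≤ 1)
    (hdisj : Pairwise (Function.onFun Disjoint (fun i => Ioc (a i) (b i))))
    (c0 : ℝ) (hc0 : 0 < c0) (N : ℕ) (hlen : ∀ i, c0 / (1 + |a i|) ^ N ≤ b i - a i) :
    Summable (fun i => 1 / (1 + |a i|) ^ (N + 2)) := by
  have h1 : Summable (fun i => ∫ x in Ioc (a i) (b i), (1 + x ^ 2)⁻¹) :=
    (MeasureTheory.hasSum_integral_iUnion (fun i => measurableSet_Ioc) hdisj
      integrable_inv_one_add_sq.integrableOn).summable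
  refine Summable.of_nonneg_of_le (fun i => by positivity) (fun i => ?_) (h1.mul_left (4 / c0))
  have ha := abs_nonneg (a i)
  have h2 : (b i - a i) * (1 / (4 * (1 + |a i|) ^ 2)) ≤ ∫ x in Ioc (a i) (b i), (1 + x ^ 2)⁻¹ := by
    have h3 : ∫ x in Ioc (a i) (b i), (1 / (4 * (1 + |a i|) ^ 2) : ℝ)
        = (b i - a i) * (1 / (4 * (1 + |a i|) ^ 2)) := by
      rw [MeasureTheory.setIntegral_const]
      simp [(hab i).le]
    rw [← h3]
    refine MeasureTheory.setIntegral_mono_on (MeasureTheory.integrableOn_const (by simp))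
      integrable_inv_one_add_sq.integrableOn measurableSet_Ioc (fun x hx => ?_)
    rw [one_div]
    refine inv_anti₀ (by positivity) ?_
    have hx1 : |x| ≤ |a i| + 1 := by
      calc |x| = |a i + (x - a i)| := by congr 1; ring
        _ ≤ |a i| + |x - a i| := abs_add_le _ _
        _ ≤ _ := by
          rw [abs_of_nonneg (by linarith [hx.1] : 0 ≤ x - a i)]; linarith [hx.2, hL1 i]
    have : x ^ 2 ≤ (|a i| + 1) ^ 2 := by
      rw [← sq_abs x]; gcongr
    nlinarith
  calc 1 / (1 + |a i|) ^ (N + 2)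
      = 4 / c0 * (c0 / (1 + |a i|) ^ N * (1 / (4 * (1 + |a i|) ^ 2))) := by
        field_simp; ring
    _ ≤ 4 / c0 * ((b i - a i) * (1 / (4 * (1 + |a i|) ^ 2))) := by
        gcongr; exact hlen i
    _ ≤ _ := by gcongr

lemma closedE (a b : ℕ → ℝ)
    (hdist : Tendsto (fun m => Metric.infDist (0 : ℝ) (Icc (a m) (b m))) atTop atTop) :
    IsClosed (⋃ m, Icc (a m) (b m)) := by
  refine LocallyFinite.isClosed_iUnion (fun x => ?_) (fun m => isClosed_Icc)
  refine ⟨Metric.ball x 1, Metric.ball_mem_nhds x one_pos, ?_⟩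
  obtain ⟨n, hn⟩ := (hdist.eventually_gt_atTop (|x| + 1)).exists_forall_of_atTop
  refine (Set.finite_lt_nat n).subset ?_
  rintro m ⟨y, hy, hyx⟩
  by_contra hcon
  have hm : n ≤ m := not_lt.1 hcon
  have h1 := hn m hm
  have h2 := Metric.infDist_le_dist_of_mem (x := (0 : ℝ)) hy
  have h3 := Metric.mem_ball.1 hyx
  have h4 : dist 0 y ≤ dist 0 x + dist x y := dist_triangle _ _ _
  rw [dist_comm x y, dist_comm 0 x, Real.dist_eq x 0, sub_zero] at h4
  linarith

theorem stmt7 (a b : ℕ → ℝ) (hab : ∀ m, a m < b m)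
    (hdisj : ∀ m n, m ≠ n → Disjoint (Icc (a m) (b m)) (Icc (a n) (b n)))
    (hdist : Tendsto (fun m => Metric.infDist (0 : ℝ) (Icc (a m) (b m))) atTop atTop)
    (E : Set ℝ) (hE : E = ⋃ m, Icc (a m) (b m))
    (c M : ℝ) (hc : 0 < c)
    (hlen : ∀ m, c * (1 + Metric.infDist (0 : ℝ) (Icc (a m) (b m))) ^ (-M) ≤ b m - a m)
    (lam : ℕ → ℝ) (hlam : ∀ n, lam n ∈ E)
    (cf : ℕ → ℝ) (hcf : ∀ n, 0 ≤ cf n)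
    (hsum : Summable (fun n => cf n * (1 + |lam n| ^ M)))
    (g : ℂ → ℂ) (hg : g = fun z => ∑' n, (cf n : ℂ) / (z - (lam n : ℂ))) :
    (∀ z ∈ (cplx E)ᶜ, Summable (fun n => ‖(cf n : ℂ) / (z - (lam n : ℂ))‖)) ∧
    AnalyticOnNhd ℂ g (cplx E)ᶜ ∧
    BoundedTypeOn g (cplx E)ᶜ := by
  have hEc : IsClosed E := hE ▸ closedE a b hdist
  have hK : IsClosed (cplx E) := Complex.isometry_ofReal.isClosedEmbedding.isClosedMap _ hEc
  have hs : Summable cf := by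
    refine Summable.of_nonneg_of_le hcf (fun n => ?_) hsum
    have h1 : 0 ≤ |lam n| ^ M := Real.rpow_nonneg (abs_nonneg _) _
    nlinarith [hcf n, mul_nonneg (hcf n) h1]
  have hlK : ∀ n, (lam n : ℂ) ∈ cplx E := fun n => ⟨lam n, hlam n, rfl⟩
  refine ⟨fun z hz => ?_, ?_, ?_⟩
  · obtain ⟨δ, hδ, hd⟩ := exists_delta hK hz
    exact (cauchy_summable hlK hcf hs hδ (hd z (Metric.mem_ball_self hδ))).1
  · rw [hg]
    exact (cauchy_diff hK hlK hcf hs).analyticOnNhd hK.isOpen_compl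
  rw [hg]
  obtain ⟨N, hN⟩ := exists_nat_ge M
  let P : ℕ → ℕ := fun m => ⌈b m - a m⌉₊
  have hL0 : ∀ m, 0 < b m - a m := fun m => sub_pos.2 (hab m)
  have hP : ∀ m, 0 < P m := fun m => Nat.ceil_pos.2 (hL0 m)
  have hPr : ∀ m, (0 : ℝ) < P m := fun m => by exact_mod_cast hP m
  let ℓ : ℕ → ℝ := fun m => (b m - a m) / P m
  have hℓ0 : ∀ m, 0 < ℓ m := fun m => div_pos (hL0 m) (hPr m)
  have hℓP : ∀ m, P m * ℓ m = b m - a m := fun m => by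
    have := (hPr m).ne'
    simp only [ℓ]; field_simp
  have hℓ1 : ∀ m, ℓ m ≤ 1 := fun m => by
    simp only [ℓ]; rw [div_le_one (hPr m)]; exact Nat.le_ceil _
  let α : (Σ m, Fin (P m)) → ℝ := fun i => a i.1 + (i.2 : ℕ) * ℓ i.1
  let β : (Σ m, Fin (P m)) → ℝ := fun i => a i.1 + ((i.2 : ℕ) + 1) * ℓ i.1
  have hαβ : ∀ i, β i - α i = ℓ i.1 := fun i => by simp only [α, β]; ring
  have hαa : ∀ i, a i.1 ≤ α i := fun i => by
    have := (hℓ0 i.1).le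
    simp only [α]
    have : (0 : ℝ) ≤ (i.2 : ℕ) * ℓ i.1 := by positivity
    linarith
  have hβb : ∀ i, β i ≤ b i.1 := fun i => by
    have h1 : (((i.2 : ℕ) : ℝ) + 1) ≤ P i.1 := by exact_mod_cast i.2.2
    have h2 := mul_le_mul_of_nonneg_right h1 (hℓ0 i.1).le
    rw [hℓP] at h2
    simp only [β]; linarith
  have hαlt : ∀ i, α i < β i := fun i => by linarith [hαβ i, hℓ0 i.1]
  have hsubI : ∀ i, Icc (α i) (β i) ⊆ Icc (a i.1) (b i.1) := fun i =>
    Icc_subset_Icc (hαa i) (hβb i)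
  have hcov : ∀ x ∈ E, ∃ i, x ∈ Icc (α i) (β i) := by
    intro x hx
    rw [hE] at hx
    obtain ⟨m, hm⟩ := mem_iUnion.1 hx
    rcases eq_or_lt_of_le hm.2 with h | h
    · refine ⟨⟨m, ⟨P m - 1, Nat.sub_lt (hP m) one_pos⟩⟩, ?_⟩
      have e : (((P m - 1 : ℕ) : ℝ)) + 1 = P m := by
        rw [Nat.cast_sub (hP m)]; simp
      have e2 : β ⟨m, ⟨P m - 1, Nat.sub_lt (hP m) one_pos⟩⟩ = b m := by
        simp only [β]; rw [e, hℓP]; ring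
      rw [h]
      exact ⟨by linarith [hαlt ⟨m, ⟨P m - 1, Nat.sub_lt (hP m) one_pos⟩⟩], e2.ge⟩
    · have h0 : 0 ≤ (x - a m) / ℓ m := div_nonneg (by linarith [hm.1]) (hℓ0 m).le
      have hlt : ⌊(x - a m) / ℓ m⌋₊ < P m := by
        rw [Nat.floor_lt h0, div_lt_iff₀ (hℓ0 m), hℓP]; linarith
      refine ⟨⟨m, ⟨_, hlt⟩⟩, ?_, ?_⟩
      · have := Nat.floor_le h0
        rw [le_div_iff₀ (hℓ0 m)] at this
        simp only [α]; linarith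
      · have := (Nat.lt_floor_add_one ((x - a m) / ℓ m)).le
        rw [div_le_iff₀ (hℓ0 m)] at this
        simp only [β]; linarith
  have hdis : Pairwise (Function.onFun Disjoint (fun i => Ioc (α i) (β i))) := by
    rintro ⟨m, j⟩ ⟨m', j'⟩ hne
    change Disjoint (Ioc _ _) (Ioc _ _)
    by_cases hmm : m = m'
    · subst hmm
      rw [Set.disjoint_left]
      rintro x ⟨h1, h2⟩ ⟨h3, h4⟩
      simp only [α, β] at h1 h2 h3 h4
      have k1 : (((j : ℕ) : ℝ)) < (j' : ℕ) + 1 :=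
        lt_of_mul_lt_mul_right (by linarith) (hℓ0 m).le
      have k2 : (((j' : ℕ) : ℝ)) < (j : ℕ) + 1 :=
        lt_of_mul_lt_mul_right (by linarith) (hℓ0 m).le
      have k1' : (j : ℕ) < j' + 1 := by exact_mod_cast k1
      have k2' : (j' : ℕ) < j + 1 := by exact_mod_cast k2
      have : j = j' := Fin.ext (by omega)
      exact hne (by rw [this])
    · exact (hdisj m m' hmm).mono (Ioc_subset_Icc_self.trans (hsubI ⟨m, j⟩))
        (Ioc_subset_Icc_self.trans (hsubI ⟨m', j'⟩))
  set c0 : ℝ := min c 1 / 2 with hc0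
  have hc0p : 0 < c0 := by have := lt_min hc one_pos; positivity
  have hlen' : ∀ i, c0 / (1 + |α i|) ^ N ≤ β i - α i := by
    intro i
    rw [hαβ]
    set m := i.1
    have hαm : α i ∈ Icc (a m) (b m) := hsubI i ⟨le_rfl, (hαlt i).le⟩
    have hd := Metric.infDist_le_dist_of_mem (x := (0 : ℝ)) hαm
    rw [dist_comm, Real.dist_eq, sub_zero] at hd
    have hd0 : 0 ≤ Metric.infDist (0 : ℝ) (Icc (a m) (b m)) := Metric.infDist_nonneg
    set d := Metric.infDist (0 : ℝ) (Icc (a m) (b m))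
    have h1 : ((1 + |α i|) ^ N)⁻¹ ≤ (1 + d) ^ (-M) := by
      rw [Real.rpow_neg (by linarith)]
      refine inv_anti₀ (Real.rpow_pos_of_pos (by linarith) _) ?_
      calc (1 + d) ^ M ≤ (1 + d) ^ (N : ℝ) := Real.rpow_le_rpow_of_exponent_le (by linarith) hN
        _ = (1 + d) ^ N := Real.rpow_natCast _ _
        _ ≤ _ := by gcongr
    set q := ((1 + |α i|) ^ N)⁻¹ with hq
    have hq0 : 0 < q := by have := abs_nonneg (α i); positivity
    have hq1 : q ≤ 1 := inv_le_one_of_one_le₀ (one_le_pow₀ (by linarith [abs_nonneg (α i)]))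
    have hLc : c * q ≤ b m - a m := (mul_le_mul_of_nonneg_left h1 hc.le).trans (hlen m)
    have hmc : min c 1 * q ≤ b m - a m := (mul_le_mul_of_nonneg_right (min_le_left _ _) hq0.le).trans hLc
    have hm1 : min c 1 * q ≤ 1 := by
      have := mul_le_mul_of_nonneg_right (min_le_right c 1) hq0.le
      linarith
    have hceil : (P m : ℝ) < b m - a m + 1 := Nat.ceil_lt_add_one (hL0 m).le
    rw [div_eq_mul_inv, ← hq, hc0]
    simp only [ℓ]
    rw [le_div_iff₀ (hPr m)]
    have h0 : 0 ≤ min c 1 * q := by have := lt_min hc one_pos; positivity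
    have hLm := hL0 m
    calc min c 1 / 2 * q * P m ≤ min c 1 / 2 * q * (b m - a m + 1) := by
          refine mul_le_mul_of_nonneg_left hceil.le (by linarith)
      _ = (min c 1 * q * (b m - a m) + min c 1 * q) / 2 := by ring
      _ ≤ b m - a m := by nlinarith
  choose idx hidx using fun n => hcov (lam n) (hlam n)
  refine core_s7 hK α β hαlt (fun i => (hαβ i).trans_le (hℓ1 _)) ?_ c0 hc0p N hlen'
    (sum_pieces α β hαlt (fun i => (hαβ i).trans_le (hℓ1 _)) hdis c0 hc0p N hlen')
    lam cf idx hidx hcf hs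
  intro i x hx
  exact ⟨x, by rw [hE]; exact mem_iUnion.2 ⟨i.1, hsubI i hx⟩, rfl⟩
end
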